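/- arXiv:2603.27045 — 2 statements merged into one kernel-verified Lean document; each statement's English description precedes it below -/
import Mathlib

section
/- There exists an absolute constant C such that the following holds. Let q ≥ 3 be prime, n ≥ 1, G = 𝔽_q^n, and let A ⊆ G be nonempty with density α = |A|/|G|. Then at least one of the following is true: (1) |⟨μ_A∗μ_A, μ_{−2·A}⟩ − 1| ≤ 2^{−1}; or (2) there is a linear subspace V ≤ G of codimension at most C·L(α)^4 such that ‖μ_A∗μ_V‖_∞ ≥ 1 + 2^{−5}. -/
open Finset BigOperators Pointwise
open scoped Classical

namespace Formal

variable {G : Type*} [AddCommGroup G] [Fintype G]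

/-- `ex f = 𝔼_{x ∈ G} f x`. -/
noncomputable def ex (f : G → ℝ) : ℝ := (∑ x, f x) / (Fintype.card G : ℝ)

/-- `ip f g = ⟨f, g⟩ = 𝔼_x f x * g x`. -/
noncomputable def ip (f g : G → ℝ) : ℝ := ex (fun x => f x * g x)

/-- `ipWt ν f g = ⟨f, g⟩_ν = 𝔼_x f x * g x * ν x`. -/
noncomputable def ipWt (ν f g : G → ℝ) : ℝ := ex (fun x => f x * g x * ν x)

/-- Convolution `f ∗ g (x) = 𝔼_y f y * g (x - y)`. -/
noncomputable def cv (f g : G → ℝ) : G → ℝ := fun x => ex (fun y => f y * g (x - y))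

/-- Difference convolution `f ∘ g (x) = 𝔼_y f y * g (x + y)`. -/
noncomputable def dcv (f g : G → ℝ) : G → ℝ := fun x => ex (fun y => f y * g (x + y))

/-- Normalized indicator measure `μ_A = (|G|/|A|) · 1_A`. -/
noncomputable def mu (A : Set G) : G → ℝ :=
  fun x => if x ∈ A then (Fintype.card G : ℝ) / (Nat.card A : ℝ) else 0

/-- Density `|A|/|G|`. -/
noncomputable def density (A : Set G) : ℝ := (Nat.card A : ℝ) / (Fintype.card G : ℝ)

/-- Relative density `|A|/|B|`. -/
noncomputable def relDensity (A B : Set G) : ℝ := (Nat.card A : ℝ) / (Nat.card B : ℝ)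

/-- `‖f‖_p = (𝔼_x |f x|^p)^{1/p}`. -/
noncomputable def lpNorm (p : ℝ) (f : G → ℝ) : ℝ := (ex (fun x => |f x| ^ p)) ^ (1 / p)

/-- `‖f‖_{p(ν)} = (𝔼_x |f x|^p ν x)^{1/p}`. -/
noncomputable def lpNormWt (p : ℝ) (ν f : G → ℝ) : ℝ := (ex (fun x => |f x| ^ p * ν x)) ^ (1 / p)

/-- `‖f‖_∞ = max_x |f x|`. -/
noncomputable def linftyNorm (f : G → ℝ) : ℝ := ⨆ x, |f x|

/-- `‖f‖_1 = 𝔼_x |f x|`. -/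
noncomputable def l1Norm (f : G → ℝ) : ℝ := ex (fun x => |f x|)

/-- Indicator function of a set. -/
noncomputable def indic (S : Set G) : G → ℝ := fun x => if x ∈ S then 1 else 0

/-- `Lq α = log (2/α)`. -/
noncomputable def Lq (α : ℝ) : ℝ := Real.log (2 / α)

/-- `iterConv f k` is the `k`-fold convolution `f ∗ ⋯ ∗ f` (for `k ≥ 1`);
`iterConv f 0` is the convolution identity. -/
noncomputable def iterConv (f : G → ℝ) : ℕ → G → ℝ
  | 0 => fun x => if x = 0 then (Fintype.card G : ℝ) else 0
  | n + 1 => cv (iterConv f n) f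

/-- Fourier transform `f̂ γ = 𝔼_x f x * conj (γ x)`. -/
noncomputable def ft (f : G → ℝ) (γ : AddChar G ℂ) : ℂ :=
  (∑ x, (f x : ℂ) * (starRingEnd ℂ) (γ x)) / (Fintype.card G : ℝ)

/-- The large spectrum `Δ_{1/2}(X)` of the measure `μ_X`. -/
noncomputable def Delta (X : Set G) : Set (AddChar G ℂ) :=
  {γ | 1 / 2 ≤ ‖ft (mu X) γ‖}

/-- A Bohr set: a finite set of characters together with a radius. -/
structure Bohr (G : Type*) [AddCommGroup G] where
  freq : Finset (AddChar G ℂ)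
  radius : ℝ

namespace Bohr

variable {G : Type*} [AddCommGroup G]

/-- The underlying set `{x : |1 - γ x| ≤ ρ for all γ ∈ Λ}` of a Bohr set. -/
def carrier (B : Bohr G) : Set G := {x | ∀ γ ∈ B.freq, ‖(1 : ℂ) - γ x‖ ≤ B.radius}

/-- The rank `|Λ|` of a Bohr set. -/
def rank (B : Bohr G) : ℕ := B.freq.card

/-- The dilate `B_δ` of a Bohr set. -/
def dilate (B : Bohr G) (δ : ℝ) : Bohr G := ⟨B.freq, δ * B.radius⟩

/-- A Bohr set of rank `d` is regular if for all `|κ| ≤ 1/(100d)`,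
`(1 - 100d|κ|)|B| ≤ |B_{1+κ}| ≤ (1 + 100d|κ|)|B|`. -/
def Regular (B : Bohr G) : Prop :=
  ∀ κ : ℝ, |κ| ≤ 1 / (100 * B.rank) →
    (1 - 100 * B.rank * |κ|) * (Nat.card B.carrier : ℝ) ≤
        (Nat.card ((B.dilate (1 + κ)).carrier) : ℝ) ∧
    (Nat.card ((B.dilate (1 + κ)).carrier) : ℝ) ≤
        (1 + 100 * B.rank * |κ|) * (Nat.card B.carrier : ℝ)

/-- `B' ⊂_r B` : `B'` is a regular dilate `B_δ` of `B` with `δ ∈ [r/2, r]`. -/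
def subR (r : ℝ) (B' B : Bohr G) : Prop :=
  ∃ δ : ℝ, r / 2 ≤ δ ∧ δ ≤ r ∧ B' = B.dilate δ ∧ B'.Regular

/-- The density `μ(B) = |B|/|G|` of a Bohr set. -/
noncomputable def dens (B : Bohr G) : ℝ := (Nat.card B.carrier : ℝ) / (Nat.card G : ℝ)

end Bohr


section Moments

lemma sum_sum_sub (H : G → ℝ) :
    ∑ x, ∑ y, H (y - x) = (Fintype.card G : ℝ) * ∑ z, H z := by
  have : ∀ x : G, ∑ y, H (y - x) = ∑ z, H z := fun x =>
    Equiv.sum_comp (Equiv.subRight x) H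
  simp [this]

lemma sum_shift_mul (b : G → ℝ) (x y : G) :
    ∑ t, b (t + x) * b (t + y) = ∑ t, b t * b (t + (y - x)) := by
  rw [← Equiv.sum_comp (Equiv.addRight x) (fun t => b t * b (t + (y - x)))]
  refine Finset.sum_congr rfl fun t _ => ?_
  simp only [Equiv.coe_addRight]
  congr 2
  abel

lemma sum_prod_corr (b φ : G → ℝ) (m : ℕ) :
    ∑ s : Fin m → G, ∑ x, ∑ y, (∏ i, b (s i + x)) * (∏ i, b (s i + y)) * φ (y - x) =
      (Fintype.card G : ℝ) * ∑ z, (∑ t, b t * b (t + z)) ^ m * φ z := by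
  rw [← sum_sum_sub fun z => (∑ t, b t * b (t + z)) ^ m * φ z, Finset.sum_comm]
  refine Finset.sum_congr rfl fun x _ => ?_
  rw [Finset.sum_comm]
  refine Finset.sum_congr rfl fun y _ => ?_
  rw [← sum_shift_mul, Fintype.sum_pow, Finset.sum_mul]
  refine Finset.sum_congr rfl fun s _ => ?_
  rw [Finset.prod_mul_distrib]

lemma sum_sq_shift (b : G → ℝ) (m : ℕ) :
    ∑ s : Fin m → G, (∑ x, ∏ i, b (s i + x)) ^ 2 =
      (Fintype.card G : ℝ) * ∑ z, (∑ t, b t * b (t + z)) ^ m := by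
  have := sum_prod_corr b (fun _ => 1) m
  simp only [mul_one] at this
  rw [← this]
  refine Finset.sum_congr rfl fun s _ => ?_
  rw [sq, Finset.sum_mul_sum]

lemma corr_pow_sum_nonneg (b : G → ℝ) (m : ℕ) :
    0 ≤ ∑ z, (∑ t, b t * b (t + z)) ^ m := by
  have h := sum_sq_shift b m
  have h0 : 0 ≤ ∑ s : Fin m → G, (∑ x, ∏ i, b (s i + x)) ^ 2 :=
    Finset.sum_nonneg fun _ _ => sq_nonneg _
  rw [h] at h0
  have : (0 : ℝ) < Fintype.card G := by exact_mod_cast Fintype.card_pos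
  exact nonneg_of_mul_nonneg_right h0 this

lemma conv_pow_sum_le (b : G → ℝ) (m : ℕ) :
    ∑ x, (∑ y, b y * b (x - y)) ^ m ≤ ∑ z, (∑ t, b t * b (t + z)) ^ m := by
  have hN : (0 : ℝ) < Fintype.card G := by exact_mod_cast Fintype.card_pos
  refine le_of_mul_le_mul_left ?_ hN
  set P : (Fin m → G) → ℝ := fun s => ∑ x, ∏ i, b (s i + x)
  have key : (Fintype.card G : ℝ) * ∑ x, (∑ y, b y * b (x - y)) ^ m =
      ∑ s : Fin m → G, P s * P (-s) := by
    have h1 : ∀ s : Fin m → G, P s * P (-s) =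
        ∑ c, ∑ x, (∏ i, b (s i + c)) * ∏ i, b (x - (s i + c)) := by
      intro s
      simp only [P, Finset.sum_mul]
      refine Finset.sum_congr rfl fun c _ => ?_
      rw [Finset.mul_sum, ← Equiv.sum_comp (Equiv.subRight c)]
      refine Finset.sum_congr rfl fun x _ => ?_
      congr 1
      refine Finset.prod_congr rfl fun i _ => ?_
      simp only [Equiv.subRight_apply, Pi.neg_apply]
      congr 1
      abel
    simp only [h1]
    rw [Finset.sum_comm]
    have h2 : ∀ c : G, ∑ s : Fin m → G, ∑ x, (∏ i, b (s i + c)) * ∏ i, b (x - (s i + c)) =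
        ∑ x, (∑ y, b y * b (x - y)) ^ m := by
      intro c
      rw [Finset.sum_comm]
      refine Finset.sum_congr rfl fun x _ => ?_
      rw [← Equiv.sum_comp (Equiv.addRight c), Fintype.sum_pow]
      refine Finset.sum_congr rfl fun s _ => ?_
      simp [Finset.prod_mul_distrib]
    simp [h2]
  have h3 : ∑ s : Fin m → G, P (-s) ^ 2 = ∑ s, P s ^ 2 :=
    Equiv.sum_comp (Equiv.neg (Fin m → G)) (fun s => P s ^ 2)
  rw [key, ← sum_sq_shift]
  have h4 : ∑ s : Fin m → G, P s * P (-s) ≤ ∑ s : Fin m → G, (P s ^ 2 + P (-s) ^ 2) / 2 :=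
    Finset.sum_le_sum fun s _ => by nlinarith [sq_nonneg (P s - P (-s))]
  rw [← Finset.sum_div, Finset.sum_add_distrib, h3] at h4
  linarith

end Moments

section Exponents

lemma sum_pow_ge_of_unbalanced {ι : Type*} [Fintype ι] (f : ι → ℝ) (hf : ∀ x, 0 ≤ f x)
    {j K : ℕ} (hj : 1 ≤ j) (hK : 2 * j ≤ K) {c : ℝ}
    (hodd : 0 ≤ ∑ x, (f x - 1) ^ (2 * j - 1))
    (heven : (Fintype.card ι : ℝ) * c ≤ ∑ x, (f x - 1) ^ (2 * j))
    (hc : 10 * (1 / 4 : ℝ) ^ (2 * j) ≤ c) :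
    (Fintype.card ι : ℝ) * (c / 2) * (5 / 4) ^ (K - 2 * j) ≤ ∑ x, f x ^ K := by
  obtain ⟨i, rfl⟩ : ∃ i, j = i + 1 := ⟨j - 1, by omega⟩
  obtain ⟨l, rfl⟩ : ∃ l, K = 2 * (i + 1) + l := ⟨K - 2 * (i + 1), by omega⟩
  have e1 : 2 * (i + 1) - 1 = 2 * i + 1 := by omega
  have e2 : 2 * (i + 1) + l - 2 * (i + 1) = l := by omega
  rw [e1] at hodd
  rw [e2]
  have hl : (0 : ℝ) < (5 / 4) ^ l := by positivity
  have hl' : (4 / 5 : ℝ) ^ l * (5 / 4) ^ l = 1 := by rw [← mul_pow]; norm_num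
  have hp : ∀ x, (f x - 1) ^ (2 * (i + 1)) + (f x - 1) ^ (2 * i + 1) ≤
      5 * (1 / 4 : ℝ) ^ (2 * (i + 1)) + (4 / 5) ^ l * f x ^ (2 * (i + 1) + l) := by
    intro x
    have hx := hf x
    have e3 : (f x - 1) ^ (2 * (i + 1)) + (f x - 1) ^ (2 * i + 1) =
        (f x - 1) ^ (2 * i + 1) * f x := by ring
    have r1 : 0 ≤ 5 * (1 / 4 : ℝ) ^ (2 * (i + 1)) := by positivity
    have r2 : 0 ≤ (4 / 5 : ℝ) ^ l * f x ^ (2 * (i + 1) + l) := by positivity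
    rw [e3]
    rcases le_or_gt (f x) 1 with h1 | h1
    · have : (f x - 1) ^ (2 * i + 1) ≤ 0 :=
        Odd.pow_nonpos ⟨i, rfl⟩ (by linarith)
      nlinarith
    rcases le_or_gt (f x) (5 / 4) with h2 | h2
    · have h3 : (f x - 1) ^ (2 * i + 1) ≤ (1 / 4) ^ (2 * i + 1) :=
        pow_le_pow_left₀ (by linarith) (by linarith) _
      have h4 : (f x - 1) ^ (2 * i + 1) * f x ≤ (1 / 4) ^ (2 * i + 1) * (5 / 4) :=
        mul_le_mul h3 h2 hx (by positivity)
      have h5 : (1 / 4 : ℝ) ^ (2 * i + 1) * (5 / 4) = 5 * (1 / 4 : ℝ) ^ (2 * (i + 1)) := by ring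
      linarith
    · have h3 : (f x - 1) ^ (2 * i + 1) ≤ f x ^ (2 * i + 1) :=
        pow_le_pow_left₀ (by linarith) (by linarith) _
      have h4 : (f x - 1) ^ (2 * i + 1) * f x ≤ f x ^ (2 * (i + 1)) := by
        calc _ ≤ f x ^ (2 * i + 1) * f x := mul_le_mul_of_nonneg_right h3 hx
          _ = _ := by ring
      have h5 : 1 ≤ (4 / 5 : ℝ) ^ l * f x ^ l := by
        rw [← mul_pow]; exact one_le_pow₀ (by linarith)
      have h6 : 0 ≤ f x ^ (2 * (i + 1)) := by positivity
      have h7 : (4 / 5 : ℝ) ^ l * f x ^ (2 * (i + 1) + l) =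
          f x ^ (2 * (i + 1)) * ((4 / 5 : ℝ) ^ l * f x ^ l) := by ring
      nlinarith
  have hs := Finset.sum_le_sum fun x (_ : x ∈ (Finset.univ : Finset ι)) => hp x
  rw [Finset.sum_add_distrib, Finset.sum_add_distrib,
    ← Finset.mul_sum Finset.univ _ ((4 / 5 : ℝ) ^ l)] at hs
  simp only [Finset.sum_const, Finset.card_univ, nsmul_eq_mul] at hs
  have hN : (0 : ℝ) ≤ Fintype.card ι := Nat.cast_nonneg _
  have h8 : (Fintype.card ι : ℝ) * (c / 2) ≤ (4 / 5) ^ l * ∑ x, f x ^ (2 * (i + 1) + l) := by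
    nlinarith
  calc _ ≤ (4 / 5) ^ l * (∑ x, f x ^ (2 * (i + 1) + l)) * (5 / 4) ^ l :=
        mul_le_mul_of_nonneg_right h8 hl.le
    _ = ((4 / 5) ^ l * (5 / 4) ^ l) * ∑ x, f x ^ (2 * (i + 1) + l) := by ring
    _ = _ := by rw [hl', one_mul]

lemma exists_stable_exponent (m : ℕ → ℝ) (hm : ∀ i, 0 < m i)
    (hlog : ∀ i, m (i + 1) ^ 2 ≤ m i * m (i + 2)) {B η ρ : ℝ} (hB : ∀ i, m (i + 1) ≤ B * m i)
    (hη : 0 ≤ η) (hρ : 1 < ρ) {K R : ℕ} (hK : ρ ^ (K + 1) * m 0 ≤ m (K + 1))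
    (hR : B ≤ (1 + η) ^ R) :
    ∃ M, K ≤ M ∧ M ≤ K + R ∧ ∃ lam, ρ ≤ lam ∧ m (M + 1) = lam * m M ∧
      m (M + 2) ≤ (1 + η) * lam ^ 2 * m M := by
  set e : ℕ → ℝ := fun i => m (i + 1) / m i
  have he : ∀ i, m (i + 1) = e i * m i := fun i => by
    simp only [e]; rw [div_mul_cancel₀ _ (hm i).ne']
  have hepos : ∀ i, 0 < e i := fun i => div_pos (hm _) (hm _)
  have heB : ∀ i, e i ≤ B := fun i => (div_le_iff₀ (hm i)).2 (hB i)
  have hmono : Monotone e := by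
    refine monotone_nat_of_le_succ fun i => ?_
    simp only [e]
    rw [div_le_div_iff₀ (hm _) (hm _)]
    have := hlog i
    nlinarith
  have hprod : ∀ i, i ≤ K + 1 → m i ≤ e K ^ i * m 0 := by
    intro i
    induction i with
    | zero => simp
    | succ i ih =>
      intro hi
      rw [he i, pow_succ]
      have h1 := ih (by omega)
      have h2 := hmono (show i ≤ K by omega)
      calc e i * m i ≤ e K * (e K ^ i * m 0) :=
            mul_le_mul h2 h1 (hm i).le (hepos K).le
        _ = _ := by ring
  have hρK : ρ ≤ e K := by
    have h1 := hK.trans (hprod (K + 1) le_rfl)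
    have h2 := le_of_mul_le_mul_right h1 (hm 0)
    exact le_of_pow_le_pow_left₀ (by omega) (hepos K).le h2
  by_contra hcon
  push Not at hcon
  have hstep : ∀ i, i ≤ R → (1 + η) ^ i * ρ ≤ e (K + i) := by
    intro i
    induction i with
    | zero => simpa using hρK
    | succ i ih =>
      intro hi
      have h1 := ih (by omega)
      have h2 := hcon (K + i) (by omega) (by omega) (e (K + i))
        (hρK.trans (hmono (by omega))) (he _)
      rw [he (K + i + 1), he (K + i)] at h2
      have h3 : (1 + η) * e (K + i) < e (K + i + 1) := by
        have hpos : 0 < e (K + i) * m (K + i) := mul_pos (hepos _) (hm _)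
        refine lt_of_mul_lt_mul_right ?_ hpos.le
        calc _ = (1 + η) * e (K + i) ^ 2 * m (K + i) := by ring
          _ < _ := h2
      calc (1 + η) ^ (i + 1) * ρ = (1 + η) * ((1 + η) ^ i * ρ) := by ring
        _ ≤ (1 + η) * e (K + i) := mul_le_mul_of_nonneg_left h1 (by linarith)
        _ ≤ e (K + i + 1) := h3.le
  have h1 := (hstep R le_rfl).trans (heB _)
  have h2 : 0 < (1 + η) ^ R := by positivity
  nlinarith

end Exponents

section Sifting

/-- The normalised number of representations of `z` as a difference of two elements of `A`,
`μ_A ∘ μ_A (z)`. -/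
noncomputable def autoCorr (A : Finset G) (z : G) : ℝ :=
  (Fintype.card G : ℝ) / (#A : ℝ) ^ 2 * ∑ t, indic (A : Set G) t * indic (A : Set G) (t + z)

lemma indic_nonneg {ι : Type*} (S : Set ι) (x : ι) : 0 ≤ indic S x := by
  unfold indic; split_ifs <;> norm_num

lemma sum_indic {ι : Type*} [Fintype ι] (A : Finset ι) : ∑ x, indic (A : Set ι) x = #A := by
  simp [indic]

lemma sum_mul_indic {ι : Type*} [Fintype ι] (A : Finset ι) (h : ι → ℝ) :
    ∑ x, indic (A : Set ι) x * h x = ∑ x ∈ A, h x := by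
  simp [indic]

lemma autoCorr_nonneg (A : Finset G) (z : G) : 0 ≤ autoCorr A z :=
  mul_nonneg (by positivity)
    (Finset.sum_nonneg fun _ _ => mul_nonneg (indic_nonneg _ _) (indic_nonneg _ _))

lemma exists_sifted (A : Finset G) (hA : A.Nonempty) (M : ℕ) {lam η : ℝ} (hlam : 0 < lam)
    (hη : 0 < η) (hM : (Fintype.card G : ℝ) ≤ ∑ z, autoCorr A z ^ M)
    (hvar : ∑ z, autoCorr A z ^ M * (autoCorr A z - lam) ^ 2 ≤
      η * lam ^ 2 * ∑ z, autoCorr A z ^ M) :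
    ∃ A₁ : Finset G, A₁.Nonempty ∧
      ((#A : ℝ) / Fintype.card G) ^ M / 4 * Fintype.card G ≤ #A₁ ∧
      ∑ x ∈ A₁, ∑ y ∈ A₁, (autoCorr A (y - x) - lam) ^ 2 ≤ 2 * η * lam ^ 2 * (#A₁ : ℝ) ^ 2 := by
  set N : ℝ := (Fintype.card G : ℝ) with hNdef
  have hN : 0 < N := by simp only [hNdef]; exact_mod_cast Fintype.card_pos
  have ha : (0 : ℝ) < #A := by exact_mod_cast hA.card_pos
  set b : G → ℝ := indic (A : Set G) with hb
  set r : G → ℝ := fun z => ∑ t, b t * b (t + z) with hr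
  set f : G → ℝ := autoCorr A with hf
  set κ : ℝ := N / (#A : ℝ) ^ 2 with hκdef
  have hκ : 0 < κ := by positivity
  have hfr : ∀ z, f z = κ * r z := fun z => rfl
  set φ : G → ℝ := fun z => 2 * η * lam ^ 2 - (f z - lam) ^ 2 with hφ
  set As : (Fin M → G) → Finset G := fun s => Finset.univ.filter fun x => ∀ i, s i + x ∈ A
    with hAs
  have hprod : ∀ (s : Fin M → G) x, ∏ i, b (s i + x) = indic (As s : Set G) x := by
    intro s x
    simp only [hb, hAs, indic, Finset.mem_coe, Finset.mem_filter, Finset.mem_univ, true_and]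
    rw [Finset.prod_ite_zero]
    simp
  have hcorr : ∀ ψ : G → ℝ, ∑ s, ∑ x ∈ As s, ∑ y ∈ As s, ψ (y - x) = N * ∑ z, r z ^ M * ψ z := by
    intro ψ
    rw [← sum_prod_corr b ψ M]
    refine Finset.sum_congr rfl fun s _ => ?_
    simp only [hprod, mul_assoc, ← Finset.mul_sum, sum_mul_indic]
  have hlin : ∑ s, (#(As s) : ℝ) = N * (#A : ℝ) ^ M := by
    simp only [← sum_indic, ← hprod]
    rw [Finset.sum_comm]
    have : ∀ x : G, ∑ s : Fin M → G, ∏ i, b (s i + x) = (#A : ℝ) ^ M := by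
      intro x
      rw [← Fintype.sum_pow (fun t => b (t + x)) M,
        ← sum_indic A, ← Equiv.sum_comp (Equiv.addRight x) (indic (A : Set G))]
      simp [hb]
    simp [this, hNdef, sum_indic]
  have hrM : N * ((#A : ℝ) ^ 2 / N) ^ M ≤ ∑ z, r z ^ M := by
    have h1 : ∑ z, r z ^ M = ((#A : ℝ) ^ 2 / N) ^ M * ∑ z, f z ^ M := by
      rw [Finset.mul_sum]
      refine Finset.sum_congr rfl fun z _ => ?_
      rw [hfr, ← mul_pow, hκdef]
      congr 1
      field_simp
    rw [h1, mul_comm]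
    exact mul_le_mul_of_nonneg_left hM (by positivity)
  have hvar' : η * lam ^ 2 * ∑ z, r z ^ M ≤ ∑ z, r z ^ M * φ z := by
    have h1 : ∑ z, r z ^ M * (f z - lam) ^ 2 ≤ η * lam ^ 2 * ∑ z, r z ^ M := by
      have hk : 0 < κ ^ M := by positivity
      refine le_of_mul_le_mul_left ?_ hk
      calc _ = ∑ z, f z ^ M * (f z - lam) ^ 2 := by
            rw [Finset.mul_sum]
            refine Finset.sum_congr rfl fun z _ => ?_
            rw [hfr, mul_pow]; ring
        _ ≤ _ := hvar
        _ = _ := by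
            have : ∑ z, f z ^ M = κ ^ M * ∑ z, r z ^ M := by
              rw [Finset.mul_sum]
              exact Finset.sum_congr rfl fun z _ => by rw [hfr, mul_pow]
            rw [this]; ring
    have h2 : ∑ z, r z ^ M * φ z =
        2 * η * lam ^ 2 * ∑ z, r z ^ M - ∑ z, r z ^ M * (f z - lam) ^ 2 := by
      rw [Finset.mul_sum, ← Finset.sum_sub_distrib]
      exact Finset.sum_congr rfl fun z _ => by simp only [hφ]; ring
    rw [h2]; linarith
  set τ : ℝ := ((#A : ℝ) / N) ^ M / 4 * N with hτ
  have hτ0 : 0 < τ := by positivity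
  have hηl : 0 < η * lam ^ 2 := by positivity
  have hsum : 0 < ∑ s, (∑ x ∈ As s, ∑ y ∈ As s, φ (y - x) - 2 * η * lam ^ 2 * τ * #(As s)) := by
    rw [Finset.sum_sub_distrib, hcorr φ, ← Finset.mul_sum, hlin]
    have h1 : N * (η * lam ^ 2 * (N * ((#A : ℝ) ^ 2 / N) ^ M)) ≤ N * ∑ z, r z ^ M * φ z :=
      mul_le_mul_of_nonneg_left
        ((mul_le_mul_of_nonneg_left hrM hηl.le).trans hvar') hN.le
    have h2 : 2 * η * lam ^ 2 * τ * (N * (#A : ℝ) ^ M) =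
        N * (η * lam ^ 2 * (N * ((#A : ℝ) ^ 2 / N) ^ M)) / 2 := by
      have : ((#A : ℝ) ^ 2 / N) ^ M = ((#A : ℝ) / N) ^ M * (#A : ℝ) ^ M := by
        rw [← mul_pow]; congr 1; ring
      rw [this, hτ]; ring
    have h3 : 0 < N * (η * lam ^ 2 * (N * ((#A : ℝ) ^ 2 / N) ^ M)) := by positivity
    linarith
  obtain ⟨s, hs⟩ : ∃ s, 0 < ∑ x ∈ As s, ∑ y ∈ As s, φ (y - x) - 2 * η * lam ^ 2 * τ * #(As s) := by
    by_contra! h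
    exact hsum.not_ge (Finset.sum_nonpos fun s _ => h s)
  have hφs : ∑ x ∈ As s, ∑ y ∈ As s, φ (y - x) = 2 * η * lam ^ 2 * (#(As s) : ℝ) ^ 2 -
      ∑ x ∈ As s, ∑ y ∈ As s, (f (y - x) - lam) ^ 2 := by
    simp only [hφ, Finset.sum_sub_distrib, Finset.sum_const, nsmul_eq_mul]
    ring
  have hV : 0 ≤ ∑ x ∈ As s, ∑ y ∈ As s, (f (y - x) - lam) ^ 2 :=
    Finset.sum_nonneg fun _ _ => Finset.sum_nonneg fun _ _ => sq_nonneg _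
  rw [hφs] at hs
  have hc0 : (0 : ℝ) ≤ #(As s) := Nat.cast_nonneg _
  have hτs : τ ≤ #(As s) := by
    by_contra h
    push Not at h
    have : (#(As s) : ℝ) ^ 2 ≤ τ * #(As s) := by nlinarith
    have := mul_le_mul_of_nonneg_left this hηl.le
    linarith
  refine ⟨As s, ?_, hτs, ?_⟩
  · rw [← Finset.card_pos]
    exact_mod_cast hτ0.trans_le hτs
  · have : 0 ≤ η * lam ^ 2 * (τ * #(As s)) := by positivity
    linarith

end Sifting

section AlmostPeriodicity

lemma card_sum_gt_le {ι : Type*} (B : Finset ι) (X : ι → ℝ) (hX : ∀ a, |X a| ≤ 1)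
    (hmean : ∑ a ∈ B, X a = 0) {δ : ℝ} (hδ : 0 ≤ δ) (hδ' : δ ≤ 2) (k : ℕ) :
    (#{y ∈ Fintype.piFinset fun _ : Fin k => B | k * δ < ∑ i, X (y i)} : ℝ) ≤
      Real.exp (-(k * δ ^ 2 / 4)) * (#B : ℝ) ^ k := by
  set P := Fintype.piFinset fun _ : Fin k => B with hP
  set D := P.filter fun y => k * δ < ∑ i, X (y i) with hD
  have h1 : ∑ y ∈ P, Real.exp (δ / 2 * ∑ i, X (y i)) =
      (∑ a ∈ B, Real.exp (δ / 2 * X a)) ^ k := by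
    simp only [Finset.mul_sum, Real.exp_sum]
    rw [hP, Finset.sum_prod_piFinset B fun (_ : Fin k) a => Real.exp (δ / 2 * X a)]
    simp
  have h2 : ∑ a ∈ B, Real.exp (δ / 2 * X a) ≤ #B * Real.exp (δ ^ 2 / 4) := by
    have h3 : ∀ a ∈ B, Real.exp (δ / 2 * X a) ≤ 1 + δ / 2 * X a + δ ^ 2 / 4 := by
      intro a _
      have hXa := abs_le.1 (hX a)
      have h4 : |δ / 2 * X a| ≤ 1 := by
        rw [abs_mul, abs_of_nonneg (by linarith)]
        nlinarith [hX a, abs_nonneg (X a)]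
      have h5 := (abs_le.1 (Real.abs_exp_sub_one_sub_id_le h4)).2
      have h6 : X a ^ 2 ≤ 1 := by nlinarith
      have h7 : (δ / 2 * X a) ^ 2 ≤ δ ^ 2 / 4 := by nlinarith [sq_nonneg δ]
      linarith
    refine (Finset.sum_le_sum h3).trans ?_
    simp only [Finset.sum_add_distrib, ← Finset.mul_sum, hmean, Finset.sum_const, nsmul_eq_mul]
    have h8 := Real.add_one_le_exp (δ ^ 2 / 4)
    have h9 : (0 : ℝ) ≤ #B := Nat.cast_nonneg _
    nlinarith
  have h3 : (#D : ℝ) * Real.exp (k * δ ^ 2 / 2) ≤ ∑ y ∈ P, Real.exp (δ / 2 * ∑ i, X (y i)) := by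
    calc (#D : ℝ) * Real.exp (k * δ ^ 2 / 2) = ∑ y ∈ D, Real.exp (k * δ ^ 2 / 2) := by simp
      _ ≤ ∑ y ∈ D, Real.exp (δ / 2 * ∑ i, X (y i)) := by
          refine Finset.sum_le_sum fun y hy => Real.exp_le_exp.2 ?_
          have := (Finset.mem_filter.1 hy).2
          nlinarith
      _ ≤ _ := Finset.sum_le_sum_of_subset_of_nonneg (Finset.filter_subset _ _)
          fun _ _ _ => (Real.exp_pos _).le
  have h4 : (∑ a ∈ B, Real.exp (δ / 2 * X a)) ^ k ≤ (#B : ℝ) ^ k * Real.exp (k * δ ^ 2 / 4) := by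
    have : Real.exp (k * δ ^ 2 / 4) = Real.exp (δ ^ 2 / 4) ^ k := by
      rw [← Real.exp_nat_mul]; congr 1; ring
    rw [this, ← mul_pow]
    exact pow_le_pow_left₀ (Finset.sum_nonneg fun _ _ => (Real.exp_pos _).le) h2 k
  have h5 := h3.trans (h1.le.trans h4)
  have h6 := mul_le_mul_of_nonneg_right h5 (Real.exp_pos (-(k * δ ^ 2 / 2))).le
  rw [mul_assoc, mul_assoc, ← Real.exp_add, ← Real.exp_add, add_neg_cancel, Real.exp_zero,
    mul_one] at h6
  calc (#D : ℝ) ≤ _ := h6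
    _ = _ := by rw [mul_comm]; congr 2; ring

lemma card_abs_sum_gt_le {ι : Type*} (B : Finset ι) (X : ι → ℝ) (hX : ∀ a, |X a| ≤ 1)
    (hmean : ∑ a ∈ B, X a = 0) {δ : ℝ} (hδ : 0 ≤ δ) (hδ' : δ ≤ 2) (k : ℕ) :
    (#{y ∈ Fintype.piFinset fun _ : Fin k => B | k * δ < |∑ i, X (y i)|} : ℝ) ≤
      2 * Real.exp (-(k * δ ^ 2 / 4)) * (#B : ℝ) ^ k := by
  have h1 := card_sum_gt_le B X hX hmean hδ hδ' k
  have h2 := card_sum_gt_le B (fun a => -X a) (by simpa using hX) (by simpa using hmean) hδ hδ' k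
  have h3 : (Fintype.piFinset fun _ : Fin k => B).filter (fun y => k * δ < |∑ i, X (y i)|) ⊆
      (Fintype.piFinset fun _ : Fin k => B).filter (fun y => k * δ < ∑ i, X (y i)) ∪
      (Fintype.piFinset fun _ : Fin k => B).filter (fun y => k * δ < ∑ i, -X (y i)) := by
    intro y hy
    simp only [Finset.mem_filter, Finset.mem_union, lt_abs, Finset.sum_neg_distrib] at hy ⊢
    tauto
  have h4 := (Finset.card_le_card h3).trans (Finset.card_union_le _ _)
  have h5 : (#{y ∈ Fintype.piFinset fun _ : Fin k => B | k * δ < |∑ i, X (y i)|} : ℝ) ≤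
      #{y ∈ Fintype.piFinset fun _ : Fin k => B | k * δ < ∑ i, X (y i)} +
      #{y ∈ Fintype.piFinset fun _ : Fin k => B | k * δ < ∑ i, -X (y i)} := by exact_mod_cast h4
  linarith

/-- The average of `s` over the translate `B + x`. -/
noncomputable def avgOn (B : Finset G) (s : G → ℝ) (x : G) : ℝ := (∑ a ∈ B, s (a + x)) / #B

lemma exists_almost_periods (B : Finset G) (hB : B.Nonempty) (s : G → ℝ) (hs0 : ∀ x, 0 ≤ s x)
    (hs1 : ∀ x, s x ≤ 1) {δ : ℝ} (hδ : 0 < δ) (hδ' : δ ≤ 2) (k : ℕ) (hk : 0 < k)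
    (hkδ : 4 * Real.exp (-(k * δ ^ 2 / 4)) ≤ δ * (#B / Fintype.card G)) :
    ∃ T : Finset G, ((#B : ℝ) / Fintype.card G) ^ k / 2 * Fintype.card G ≤ #T ∧
      ∀ t ∈ T, ∀ t' ∈ T,
        (#{w | 2 * δ < |avgOn B s w - avgOn B s (w + (t - t'))|} : ℝ) ≤ 2 * δ * #B := by
  have hN : (0 : ℝ) < (Fintype.card G : ℝ) := by exact_mod_cast Fintype.card_pos
  set N : ℝ := (Fintype.card G : ℝ) with hNdef
  have hb : (0 : ℝ) < #B := by exact_mod_cast hB.card_pos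
  have hk' : (0 : ℝ) < k := by exact_mod_cast hk
  set e : G → ℝ := avgOn B s with he
  have he0 : ∀ x, 0 ≤ e x := fun x => div_nonneg (Finset.sum_nonneg fun _ _ => hs0 _) hb.le
  have he1 : ∀ x, e x ≤ 1 := fun x => by
    refine (div_le_one hb).2 ?_
    calc ∑ a ∈ B, s (a + x) ≤ ∑ a ∈ B, (1 : ℝ) := Finset.sum_le_sum fun _ _ => hs1 _
      _ = #B := by simp
  set P := Fintype.piFinset fun _ : Fin k => B with hP
  have hPc : (#P : ℝ) = (#B : ℝ) ^ k := by simp [hP]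
  set bad : (Fin k → G) → Finset G := fun y =>
    Finset.univ.filter fun x => k * δ < |∑ i, (s (y i + x) - e x)| with hbad
  have hsum : ∑ y ∈ P, (#(bad y) : ℝ) ≤ δ * #B * #P / 2 := by
    have h1 : ∑ y ∈ P, (#(bad y) : ℝ) =
        ∑ x : G, (#{y ∈ P | k * δ < |∑ i, (s (y i + x) - e x)|} : ℝ) := by
      simp only [hbad, Finset.card_filter, Nat.cast_sum]
      rw [Finset.sum_comm]
    rw [h1]
    have h2 : ∀ x : G, (#{y ∈ P | k * δ < |∑ i, (s (y i + x) - e x)|} : ℝ) ≤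
        2 * Real.exp (-(k * δ ^ 2 / 4)) * (#B : ℝ) ^ k := by
      intro x
      refine card_abs_sum_gt_le B (fun a => s (a + x) - e x) (fun a => ?_) ?_ hδ.le hδ' k
      · exact abs_le.2 ⟨by linarith [hs0 (a + x), he1 x], by linarith [hs1 (a + x), he0 x]⟩
      · rw [Finset.sum_sub_distrib, Finset.sum_const, nsmul_eq_mul, he, avgOn,
          mul_div_cancel₀ _ hb.ne', sub_self]
    refine (Finset.sum_le_sum fun x _ => h2 x).trans ?_
    rw [Finset.sum_const, nsmul_eq_mul, Finset.card_univ, hPc, ← hNdef]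
    have h3 : N * (4 * Real.exp (-(k * δ ^ 2 / 4))) ≤ δ * #B := by
      calc _ ≤ N * (δ * (#B / N)) := mul_le_mul_of_nonneg_left hkδ hN.le
        _ = _ := by field_simp
    have h4 : (0 : ℝ) ≤ (#B : ℝ) ^ k := by positivity
    nlinarith
  set Good := P.filter fun y => (#(bad y) : ℝ) ≤ δ * #B with hGood
  have hGoodc : (#P : ℝ) / 2 ≤ #Good := by
    have h1 : (#(P.filter fun y => ¬ (#(bad y) : ℝ) ≤ δ * #B) : ℝ) * (δ * #B) ≤
        ∑ y ∈ P, (#(bad y) : ℝ) := by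
      calc _ = ∑ y ∈ P.filter fun y => ¬ (#(bad y) : ℝ) ≤ δ * #B, δ * #B := by simp
        _ ≤ ∑ y ∈ P.filter fun y => ¬ (#(bad y) : ℝ) ≤ δ * #B, (#(bad y) : ℝ) :=
            Finset.sum_le_sum fun y hy => (not_le.1 (Finset.mem_filter.1 hy).2).le
        _ ≤ _ := Finset.sum_le_sum_of_subset_of_nonneg (Finset.filter_subset _ _)
            fun _ _ _ => Nat.cast_nonneg _
    have h2 : (#Good : ℝ) + #(P.filter fun y => ¬ (#(bad y) : ℝ) ≤ δ * #B) = #P := by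
      exact_mod_cast Finset.card_filter_add_card_filter_not _
    have h3 : 0 < δ * #B := by positivity
    have h4 : (#(P.filter fun y => ¬ (#(bad y) : ℝ) ≤ δ * #B) : ℝ) ≤ #P / 2 := by
      refine le_of_mul_le_mul_right ?_ h3
      linarith
    linarith
  set T : (Fin k → G) → Finset G := fun z =>
    Finset.univ.filter fun t => (fun i => z i + t) ∈ Good with hT
  have hTsum : ∑ z, (#(T z) : ℝ) = N * #Good := by
    have h1 : ∀ t : G, ∑ z : Fin k → G, (if (fun i => z i + t) ∈ Good then (1 : ℝ) else 0) =
        #Good := by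
      intro t
      have := Equiv.sum_comp (Equiv.addRight (fun _ : Fin k => t))
        (fun z => if z ∈ Good then (1 : ℝ) else 0)
      rw [show (∑ z : Fin k → G, (if (fun i => z i + t) ∈ Good then (1 : ℝ) else 0)) = _
        from this]
      simp
    simp only [hT, Finset.card_filter, Nat.cast_sum, Nat.cast_ite, Nat.cast_one, Nat.cast_zero]
    rw [Finset.sum_comm]
    simp [h1, hNdef]
  obtain ⟨z, hz⟩ : ∃ z, ((#B : ℝ) / N) ^ k / 2 * N ≤ #(T z) := by
    by_contra! h
    have h1 := Finset.sum_lt_sum_of_nonempty (Finset.univ_nonempty (α := Fin k → G))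
      fun z _ => h z
    rw [hTsum, Finset.sum_const, nsmul_eq_mul, Finset.card_univ] at h1
    have h2 : ((Fintype.card (Fin k → G) : ℕ) : ℝ) = N ^ k := by simp [hNdef]
    rw [h2] at h1
    have h3 : N ^ k * (((#B : ℝ) / N) ^ k / 2 * N) = N * (#P / 2) := by
      rw [hPc, div_pow]; field_simp
    rw [h3] at h1
    exact (lt_of_mul_lt_mul_left h1 hN.le).not_ge hGoodc
  refine ⟨T z, hz, fun t ht t' ht' => ?_⟩
  have hg : ∀ t ∈ T z, (#(bad fun i => z i + t) : ℝ) ≤ δ * #B := fun t ht =>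
    (Finset.mem_filter.1 (Finset.mem_filter.1 ht).2).2
  have hsub : (Finset.univ.filter fun w => 2 * δ < |e w - e (w + (t - t'))|) ⊆
      (bad fun i => z i + t) ∪
        (bad fun i => z i + t').map (Equiv.subRight (t - t')).toEmbedding := by
    intro w hw
    by_contra hcon
    simp only [Finset.mem_union, not_or, Finset.mem_map_equiv] at hcon
    obtain ⟨c1, c2⟩ := hcon
    simp only [hbad, Finset.mem_filter, Finset.mem_univ, true_and, not_lt] at c1 c2 hw
    have e1 : (Equiv.subRight (t - t')).symm w = w + (t - t') := by
      simp [Equiv.subRight]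
    rw [e1] at c2
    have e2 : ∀ i, z i + t' + (w + (t - t')) = z i + t + w := fun i => by abel
    simp only [e2, Finset.sum_sub_distrib, Finset.sum_const, Finset.card_univ, Fintype.card_fin,
      nsmul_eq_mul] at c1 c2
    have c1' := abs_le.1 c1
    have c2' := abs_le.1 c2
    have : |e w - e (w + (t - t'))| ≤ 2 * δ := by
      refine abs_le.2 ⟨?_, ?_⟩
      · refine le_of_mul_le_mul_left ?_ hk'
        linarith
      · refine le_of_mul_le_mul_left ?_ hk'
        linarith
    linarith
  have h1 := (Finset.card_le_card hsub).trans (Finset.card_union_le _ _)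
  rw [Finset.card_map] at h1
  have h2 : (#(Finset.univ.filter fun w => 2 * δ < |e w - e (w + (t - t'))|) : ℝ) ≤
      #(bad fun i => z i + t) + #(bad fun i => z i + t') := by exact_mod_cast h1
  linarith [hg t ht, hg t' ht']

lemma exists_shift_invariant_set (B : Finset G) (hB : B.Nonempty) (s : G → ℝ)
    (hs0 : ∀ x, 0 ≤ s x) (hs1 : ∀ x, s x ≤ 1) {δ : ℝ} (hδ : 0 < δ) (hδ' : δ ≤ 2) (k : ℕ)
    (hk : 0 < k) (hkδ : 4 * Real.exp (-(k * δ ^ 2 / 4)) ≤ δ * (#B / Fintype.card G)) :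
    ∃ T : Finset G, ((#B : ℝ) / Fintype.card G) ^ k / 2 * Fintype.card G ≤ #T ∧
      ∀ t ∈ T, ∀ t' ∈ T, ∑ a ∈ B, ∑ a' ∈ B, s (a - a') - 4 * δ * (#B : ℝ) ^ 2 ≤
        ∑ a ∈ B, ∑ a' ∈ B, s (a - a' + (t - t')) := by
  obtain ⟨T, hT, hTp⟩ := exists_almost_periods B hB s hs0 hs1 hδ hδ' k hk hkδ
  refine ⟨T, hT, fun t ht t' ht' => ?_⟩
  have hb : (0 : ℝ) < #B := by exact_mod_cast hB.card_pos
  set e : G → ℝ := avgOn B s with he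
  have he0 : ∀ x, 0 ≤ e x := fun x => div_nonneg (Finset.sum_nonneg fun _ _ => hs0 _) hb.le
  have he1 : ∀ x, e x ≤ 1 := fun x => by
    refine (div_le_one hb).2 ?_
    calc ∑ a ∈ B, s (a + x) ≤ ∑ a ∈ B, (1 : ℝ) := Finset.sum_le_sum fun _ _ => hs1 _
      _ = #B := by simp
  have hΨ : ∀ v, ∑ a ∈ B, ∑ a' ∈ B, s (a - a' + v) = #B * ∑ a' ∈ B, e (-a' + v) := by
    intro v
    rw [Finset.sum_comm, Finset.mul_sum]
    refine Finset.sum_congr rfl fun a' _ => ?_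
    rw [he, avgOn, mul_div_cancel₀ _ hb.ne']
    refine Finset.sum_congr rfl fun a _ => ?_
    congr 1; abel
  have h0 := hΨ 0
  simp only [add_zero] at h0
  rw [h0, hΨ (t - t')]
  set W := Finset.univ.filter fun w => 2 * δ < |e w - e (w + (t - t'))| with hW
  have hWc : (#W : ℝ) ≤ 2 * δ * #B := hTp t ht t' ht'
  have hpt : ∀ w, e w - e (w + (t - t')) ≤ 2 * δ + indic (W : Set G) w := by
    intro w
    by_cases hw : w ∈ W
    · simp only [indic, Finset.mem_coe, hw, if_true]
      linarith [he1 w, he0 (w + (t - t'))]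
    · have : |e w - e (w + (t - t'))| ≤ 2 * δ := by simpa [hW] using hw
      have := (abs_le.1 this).2
      simp only [indic, Finset.mem_coe, hw, if_false]
      linarith
  have hsum : ∑ a' ∈ B, (e (-a') - e (-a' + (t - t'))) ≤ 4 * δ * #B := by
    refine (Finset.sum_le_sum fun a' _ => hpt (-a')).trans ?_
    rw [Finset.sum_add_distrib, Finset.sum_const, nsmul_eq_mul]
    have h1 : ∑ a' ∈ B, indic (W : Set G) (-a') ≤ #W := by
      rw [← sum_indic, ← Equiv.sum_comp (Equiv.neg G)]
      exact Finset.sum_le_sum_of_subset_of_nonneg (Finset.subset_univ _)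
        fun _ _ _ => indic_nonneg _ _
    linarith
  rw [Finset.sum_sub_distrib] at hsum
  have := mul_le_mul_of_nonneg_left hsum hb.le
  linarith

end AlmostPeriodicity

section Spectrum

variable {q n : ℕ} [Fact q.Prime]

/-- The character `x ↦ exp (2πi (ξ ⬝ x) / q)` of `𝔽_q^n`. -/
noncomputable def dotChar (ξ : Fin n → ZMod q) : AddChar (Fin n → ZMod q) ℂ :=
  ZMod.stdAddChar.compAddMonoidHom (dotProductBilin (ZMod q) (ZMod q) ξ).toAddMonoidHom

lemma dotChar_apply (ξ x : Fin n → ZMod q) : dotChar ξ x = ZMod.stdAddChar (ξ ⬝ᵥ x) := rfl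

lemma dotChar_eq_one_iff {ξ x : Fin n → ZMod q} : dotChar ξ x = 1 ↔ ξ ⬝ᵥ x = 0 := by
  rw [dotChar_apply, ← AddChar.map_zero_eq_one (ZMod.stdAddChar (N := q)),
    ZMod.injective_stdAddChar.eq_iff]

lemma dotChar_add_left (ξ η x : Fin n → ZMod q) :
    dotChar (ξ + η) x = dotChar ξ x * dotChar η x := by
  simp only [dotChar_apply, add_dotProduct, AddChar.map_add_eq_mul]

lemma sum_dotChar (x : Fin n → ZMod q) :
    ∑ ξ, dotChar ξ x = if x = 0 then (Fintype.card (Fin n → ZMod q) : ℂ) else 0 := by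
  split_ifs with h
  · simp [h, Finset.card_univ]
  · obtain ⟨i, hi⟩ := Function.ne_iff.1 h
    have hη : dotChar (Pi.single i 1) x ≠ 1 := by
      rw [Ne, dotChar_eq_one_iff, single_one_dotProduct]
      exact hi
    have h1 : ∑ ξ, dotChar ξ x = (∑ ξ, dotChar ξ x) * dotChar (Pi.single i 1) x := by
      rw [Finset.sum_mul, ← Equiv.sum_comp (Equiv.addRight (Pi.single i 1))]
      exact Finset.sum_congr rfl fun ξ _ => dotChar_add_left _ _ _
    have h2 : (∑ ξ, dotChar ξ x) * (dotChar (Pi.single i 1) x - 1) = 0 := by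
      rw [mul_sub, mul_one, ← h1, sub_self]
    exact (mul_eq_zero.1 h2).resolve_right (sub_ne_zero.2 hη)

lemma sub_sq_le_log_one_add {y : ℝ} (hy : |y| ≤ 1 / 4) : y - y ^ 2 ≤ Real.log (1 + y) := by
  have h := Real.abs_log_sub_add_sum_range_le (x := -y) (by rw [abs_neg]; linarith) 2
  simp only [Finset.sum_range_succ, Finset.sum_range_zero, abs_neg, sub_neg_eq_add] at h
  norm_num at h
  have h0 := abs_nonneg y
  have h1 : |y| ^ 3 / (1 - |y|) ≤ y ^ 2 / 2 := by
    rw [div_le_iff₀ (by linarith), ← sq_abs y]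
    nlinarith [sq_nonneg |y|]
  have h2 := (abs_le.1 (h.trans h1)).1
  linarith

lemma finrank_le_inf_ker_add_one (V : Submodule (ZMod q) (Fin n → ZMod q))
    (φ : (Fin n → ZMod q) →ₗ[ZMod q] ZMod q) :
    Module.finrank (ZMod q) V ≤ Module.finrank (ZMod q) ↥(V ⊓ LinearMap.ker φ) + 1 := by
  have h1 := Submodule.finrank_sup_add_finrank_inf_eq V (LinearMap.ker φ)
  have h2 := LinearMap.finrank_range_add_finrank_ker φ
  have h3 : Module.finrank (ZMod q) ↥(LinearMap.range φ) ≤ 1 := by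
    simpa using Submodule.finrank_le (LinearMap.range φ)
  have h4 := Submodule.finrank_le (V ⊔ LinearMap.ker φ)
  omega

lemma exists_re_mul_dotChar (T : Finset (Fin n → ZMod q)) (ξ : Fin n → ZMod q) :
    ∃ c : ℂ, ‖c‖ ≤ 1 ∧ ∑ t ∈ T, (c * dotChar ξ t).re = ‖∑ t ∈ T, dotChar ξ t‖ := by
  set S := ∑ t ∈ T, dotChar ξ t with hS
  refine ⟨(starRingEnd ℂ) S / ‖S‖, ?_, ?_⟩
  · rw [norm_div, RCLike.norm_conj, Complex.norm_real, norm_norm]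
    exact div_self_le_one _
  · rw [← Complex.re_sum, ← Finset.mul_sum, ← hS, div_mul_eq_mul_div, mul_comm, Complex.mul_conj,
      Complex.normSq_eq_norm_sq]
    rcases eq_or_ne ‖S‖ 0 with h | h
    · simp [h]
    · rw [← Complex.ofReal_div, Complex.ofReal_re, sq, mul_div_assoc, div_self h, mul_one]

lemma sum_mul_dotChar_eq_zero {Z : (Fin n → ZMod q) → ℝ} {v ξ : Fin n → ZMod q}
    (hZ : ∀ x, Z (x + v) = Z x) (hξ : ξ ⬝ᵥ v ≠ 0) : ∑ x, (Z x : ℂ) * dotChar ξ x = 0 := by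
  have h1 : ∑ x, (Z x : ℂ) * dotChar ξ x = (∑ x, (Z x : ℂ) * dotChar ξ x) * dotChar ξ v := by
    rw [Finset.sum_mul, ← Equiv.sum_comp (Equiv.addRight v)]
    refine Finset.sum_congr rfl fun x _ => ?_
    rw [Equiv.coe_addRight, hZ, AddChar.map_add_eq_mul, mul_assoc]
  have h2 : (∑ x, (Z x : ℂ) * dotChar ξ x) * (dotChar ξ v - 1) = 0 := by
    rw [mul_sub, mul_one, ← h1, sub_self]
  exact (mul_eq_zero.1 h2).resolve_right (sub_ne_zero.2 (mt dotChar_eq_one_iff.1 hξ))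

/-- Either few linear conditions annihilate the large spectrum of `T`, or there is a positive
density, invariant under a subspace of small codimension, with large mean logarithm on `T`. -/
lemma exists_annihilator_or_density (T : Finset (Fin n → ZMod q)) {κ : ℝ} (hκ : 0 < κ)
    (hκ' : κ ≤ 1 / 2) (d : ℕ) :
    (∃ V : Submodule (ZMod q) (Fin n → ZMod q), n ≤ Module.finrank (ZMod q) V + d ∧
      ∀ ξ, κ * #T ≤ ‖∑ t ∈ T, dotChar ξ t‖ → ∀ v ∈ V, ξ ⬝ᵥ v = 0) ∨
    ∃ (V : Submodule (ZMod q) (Fin n → ZMod q)) (Z : (Fin n → ZMod q) → ℝ),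
      n ≤ Module.finrank (ZMod q) V + d ∧ (∀ x, 0 < Z x) ∧ (∀ v ∈ V, ∀ x, Z (x + v) = Z x) ∧
      ∑ x, Z x = Fintype.card (Fin n → ZMod q) ∧
      d * (κ ^ 2 / 4) * #T ≤ ∑ t ∈ T, Real.log (Z t) := by
  induction d with
  | zero =>
    refine Or.inr ⟨⊤, fun _ => 1, by simp, by simp, by simp, by simp, by simp⟩
  | succ d ih =>
    rcases ih with ⟨V, hV, h⟩ | ⟨V, Z, hV, hpos, hinv, hsum, hlog⟩
    · exact Or.inl ⟨V, by omega, h⟩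
    by_cases hspec : ∀ ξ, κ * #T ≤ ‖∑ t ∈ T, dotChar ξ t‖ → ∀ v ∈ V, ξ ⬝ᵥ v = 0
    · exact Or.inl ⟨V, by omega, hspec⟩
    push Not at hspec
    obtain ⟨ξ, hξ, v, hv, hξv⟩ := hspec
    obtain ⟨c, hc, hcT⟩ := exists_re_mul_dotChar T ξ
    set w : (Fin n → ZMod q) → ℝ := fun x => (c * dotChar ξ x).re with hw
    have hw1 : ∀ x, |w x| ≤ 1 := fun x => by
      refine (Complex.abs_re_le_norm _).trans ?_
      rwa [norm_mul, AddChar.norm_apply, mul_one]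
    have hy : ∀ x, |κ / 2 * w x| ≤ κ / 2 := fun x => by
      rw [abs_mul, abs_of_pos (by linarith)]
      nlinarith [hw1 x]
    have hpos' : ∀ x, 0 < 1 + κ / 2 * w x := fun x => by
      linarith [(abs_le.1 (hy x)).1]
    right
    refine ⟨V ⊓ LinearMap.ker (dotProductBilin (ZMod q) (ZMod q) ξ),
      fun x => Z x * (1 + κ / 2 * w x), ?_, fun x => mul_pos (hpos x) (hpos' x), ?_, ?_, ?_⟩
    · have := finrank_le_inf_ker_add_one V (dotProductBilin (ZMod q) (ZMod q) ξ)
      omega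
    · rintro u ⟨hu, hu'⟩ x
      have h1 : dotChar ξ u = 1 := dotChar_eq_one_iff.2 hu'
      simp only [hw, hinv u hu, AddChar.map_add_eq_mul, h1, mul_one]
    · have h1 := sum_mul_dotChar_eq_zero (fun x => hinv v hv x) hξv
      have h2 : ∑ x, Z x * w x = 0 := by
        have : ∑ x, Z x * w x = (c * ∑ x, (Z x : ℂ) * dotChar ξ x).re := by
          rw [Finset.mul_sum, Complex.re_sum]
          refine Finset.sum_congr rfl fun x _ => ?_
          rw [mul_left_comm, Complex.re_ofReal_mul]
        rw [this, h1, mul_zero, Complex.zero_re]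
      calc ∑ x, Z x * (1 + κ / 2 * w x) = ∑ x, Z x + κ / 2 * ∑ x, Z x * w x := by
            rw [Finset.mul_sum, ← Finset.sum_add_distrib]
            exact Finset.sum_congr rfl fun x _ => by ring
        _ = _ := by rw [h2, hsum]; ring
    · have h1 : ∀ t, Real.log (Z t) + (κ / 2 * w t - κ ^ 2 / 4) ≤
          Real.log (Z t * (1 + κ / 2 * w t)) := fun t => by
        rw [Real.log_mul (hpos t).ne' (hpos' t).ne']
        have h2 := sub_sq_le_log_one_add ((hy t).trans (by linarith))
        have h3 : (κ / 2 * w t) ^ 2 ≤ (κ / 2) ^ 2 := sq_le_sq' (abs_le.1 (hy t)).1 (abs_le.1 (hy t)).2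
        linarith
      refine le_trans ?_ (Finset.sum_le_sum fun t _ => h1 t)
      rw [Finset.sum_add_distrib, Finset.sum_sub_distrib, ← Finset.mul_sum, hcT, Finset.sum_const,
        nsmul_eq_mul]
      push_cast
      nlinarith

lemma exists_annihilator (T : Finset (Fin n → ZMod q)) (hT : T.Nonempty) {κ : ℝ} (hκ : 0 < κ)
    (hκ' : κ ≤ 1 / 2) (d : ℕ)
    (hd : Real.log (Fintype.card (Fin n → ZMod q) / #T) < d * (κ ^ 2 / 4)) :
    ∃ V : Submodule (ZMod q) (Fin n → ZMod q), n ≤ Module.finrank (ZMod q) V + d ∧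
      ∀ ξ, κ * #T ≤ ‖∑ t ∈ T, dotChar ξ t‖ → ∀ v ∈ V, ξ ⬝ᵥ v = 0 := by
  refine (exists_annihilator_or_density T hκ hκ' d).resolve_right ?_
  rintro ⟨V, Z, -, hpos, -, hsum, hlog⟩
  have hT' : (0 : ℝ) < #T := by exact_mod_cast hT.card_pos
  have hN : (0 : ℝ) < Fintype.card (Fin n → ZMod q) := by exact_mod_cast Fintype.card_pos
  set N : ℝ := (Fintype.card (Fin n → ZMod q) : ℝ) with hNdef
  have h1 : ∀ t, Real.log (Z t) ≤ Real.log (N / #T) + (#T / N * Z t - 1) := fun t => by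
    have h2 := Real.log_le_sub_one_of_pos (show 0 < #T / N * Z t from
      mul_pos (by positivity) (hpos t))
    rw [Real.log_mul (by positivity) (hpos t).ne', Real.log_div hT'.ne' hN.ne'] at h2
    rw [Real.log_div hN.ne' hT'.ne']
    linarith
  have h2 := hlog.trans (Finset.sum_le_sum fun t _ => h1 t)
  rw [Finset.sum_add_distrib, Finset.sum_sub_distrib, ← Finset.mul_sum] at h2
  simp only [Finset.sum_const, nsmul_eq_mul, mul_one] at h2
  have h3 : ∑ t ∈ T, Z t ≤ N := hsum ▸
    Finset.sum_le_sum_of_subset_of_nonneg (Finset.subset_univ _) fun x _ _ => (hpos x).le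
  have h4 : #T / N * ∑ t ∈ T, Z t ≤ #T := by
    calc _ ≤ #T / N * N := mul_le_mul_of_nonneg_left h3 (by positivity)
      _ = #T := div_mul_cancel₀ _ hN.ne'
  nlinarith

end Spectrum

section Fourier

variable {q n : ℕ} [Fact q.Prime]

/-- `|\hat{μ_B}(ξ)|²`. -/
noncomputable def sqCoeff (B : Finset (Fin n → ZMod q)) (ξ : Fin n → ZMod q) : ℝ :=
  ‖∑ b ∈ B, dotChar ξ b‖ ^ 2 / (#B : ℝ) ^ 2

lemma sqCoeff_nonneg (B : Finset (Fin n → ZMod q)) (ξ : Fin n → ZMod q) : 0 ≤ sqCoeff B ξ := by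
  unfold sqCoeff; positivity

lemma sqCoeff_le_one (B : Finset (Fin n → ZMod q)) (ξ : Fin n → ZMod q) : sqCoeff B ξ ≤ 1 := by
  refine div_le_one_of_le₀ (pow_le_pow_left₀ (norm_nonneg _) ?_ 2) (by positivity)
  refine (norm_sum_le _ _).trans ?_
  simp [AddChar.norm_apply]

lemma sqCoeff_eq_one {B : Finset (Fin n → ZMod q)} (hB : B.Nonempty) {ξ : Fin n → ZMod q}
    (h : ∀ b ∈ B, ξ ⬝ᵥ b = 0) : sqCoeff B ξ = 1 := by
  have hb : (#B : ℝ) ≠ 0 := by exact_mod_cast hB.card_pos.ne'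
  rw [sqCoeff, Finset.sum_congr rfl fun b hb => dotChar_eq_one_iff.2 (h b hb)]
  simp [hb]

lemma sum_sum_dotChar_sub (B : Finset (Fin n → ZMod q)) (ξ : Fin n → ZMod q) :
    ∑ b ∈ B, ∑ b' ∈ B, dotChar ξ (b - b') = (‖∑ b ∈ B, dotChar ξ b‖ ^ 2 : ℝ) := by
  rw [← Complex.normSq_eq_norm_sq, ← Complex.mul_conj, map_sum, Finset.sum_mul_sum]
  refine Finset.sum_congr rfl fun b _ => Finset.sum_congr rfl fun b' _ => ?_
  rw [sub_eq_add_neg, AddChar.map_add_eq_mul, AddChar.map_neg_eq_conj]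

lemma autoCorr_eq_sum (A : Finset (Fin n → ZMod q)) (z : Fin n → ZMod q) :
    (autoCorr A z : ℂ) = ∑ ξ, (sqCoeff A ξ : ℂ) * dotChar ξ z := by
  have h1 : ∑ ξ, ((‖∑ b ∈ A, dotChar ξ b‖ ^ 2 : ℝ) : ℂ) * dotChar ξ z =
      Fintype.card (Fin n → ZMod q) *
        ∑ t, (indic (A : Set (Fin n → ZMod q)) t * indic (A : Set (Fin n → ZMod q)) (t + z) : ℝ) := by
    simp only [← sum_sum_dotChar_sub, Finset.sum_mul, ← AddChar.map_add_eq_mul]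
    rw [Finset.sum_comm, sum_mul_indic A fun t => indic (A : Set (Fin n → ZMod q)) (t + z),
      Complex.ofReal_sum, Finset.mul_sum]
    refine Finset.sum_congr rfl fun a _ => ?_
    rw [Finset.sum_comm]
    have h2 : ∀ b : Fin n → ZMod q, a - b + z = 0 ↔ a + z = b := fun b => by
      rw [sub_add_eq_add_sub, sub_eq_zero]
    simp only [sum_dotChar, h2, Finset.sum_ite_eq, indic, Finset.mem_coe]
    split_ifs <;> simp
  have h3 : ∑ ξ, (sqCoeff A ξ : ℂ) * dotChar ξ z =
      (∑ ξ, ((‖∑ b ∈ A, dotChar ξ b‖ ^ 2 : ℝ) : ℂ) * dotChar ξ z) / (#A : ℂ) ^ 2 := by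
    rw [Finset.sum_div]
    refine Finset.sum_congr rfl fun ξ _ => ?_
    simp only [sqCoeff]
    push_cast
    ring
  rw [h3, h1, autoCorr]
  push_cast
  ring

lemma sum_autoCorr_eq (A B T : Finset (Fin n → ZMod q)) (hB : B.Nonempty) (hT : T.Nonempty) :
    ∑ b ∈ B, ∑ b' ∈ B, ∑ t ∈ T, ∑ t' ∈ T, autoCorr A (b - b' + (t - t')) =
      (#B : ℝ) ^ 2 * (#T : ℝ) ^ 2 * ∑ ξ, sqCoeff A ξ * sqCoeff B ξ * sqCoeff T ξ := by
  have hb : (#B : ℝ) ≠ 0 := by exact_mod_cast hB.card_pos.ne'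
  have ht : (#T : ℝ) ≠ 0 := by exact_mod_cast hT.card_pos.ne'
  have h1 : ((∑ b ∈ B, ∑ b' ∈ B, ∑ t ∈ T, ∑ t' ∈ T, autoCorr A (b - b' + (t - t')) : ℝ) : ℂ) =
      ((∑ ξ, sqCoeff A ξ * (‖∑ b ∈ B, dotChar ξ b‖ ^ 2 * ‖∑ t ∈ T, dotChar ξ t‖ ^ 2) : ℝ) : ℂ) := by
    simp only [Complex.ofReal_sum, Complex.ofReal_mul, ← sum_sum_dotChar_sub, autoCorr_eq_sum,
      AddChar.map_add_eq_mul]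
    symm
    simp only [Finset.sum_mul]
    simp only [Finset.mul_sum]
    refine Finset.sum_comm.trans (Finset.sum_congr rfl fun b _ => ?_)
    refine Finset.sum_comm.trans (Finset.sum_congr rfl fun b' _ => ?_)
    refine Finset.sum_comm.trans (Finset.sum_congr rfl fun t _ => ?_)
    exact Finset.sum_comm
  rw [Complex.ofReal_inj.1 h1, Finset.mul_sum]
  refine Finset.sum_congr rfl fun ξ _ => ?_
  simp only [sqCoeff]
  field_simp

lemma sum_autoCorr_subspace_ge (A B T : Finset (Fin n → ZMod q)) (hB : B.Nonempty)
    (hT : T.Nonempty) (V : Submodule (ZMod q) (Fin n → ZMod q)) {κ u l : ℝ}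
    (hV : ∀ ξ, κ * #T ≤ ‖∑ t ∈ T, dotChar ξ t‖ → ∀ v ∈ V, ξ ⬝ᵥ v = 0)
    (hl : ∀ t ∈ T, ∀ t' ∈ T, l * (#B : ℝ) ^ 2 ≤
      ∑ b ∈ B, ∑ b' ∈ B, autoCorr A (b - b' + (t - t')))
    (hu : ∑ b ∈ B, ∑ b' ∈ B, autoCorr A (b - b') ≤ u * (#B : ℝ) ^ 2) :
    (l - κ ^ 2 * u) * (#{v | v ∈ V} : ℝ) ^ 2 ≤
      ∑ v with v ∈ V, ∑ v' with v' ∈ V, autoCorr A (v - v') := by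
  have hb : (0 : ℝ) < #B := by exact_mod_cast hB.card_pos
  have ht : (0 : ℝ) < #T := by exact_mod_cast hT.card_pos
  set W : Finset (Fin n → ZMod q) := Finset.univ.filter fun v => v ∈ V with hW
  have hWne : W.Nonempty := ⟨0, by simp [hW]⟩
  have hw : (0 : ℝ) < #W := by exact_mod_cast hWne.card_pos
  have h0 : ∀ C : Finset (Fin n → ZMod q), C.Nonempty →
      ∑ b ∈ C, ∑ b' ∈ C, autoCorr A (b - b') =
        (#C : ℝ) ^ 2 * ∑ ξ, sqCoeff A ξ * sqCoeff C ξ := by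
    intro C hC
    have h1 := sum_autoCorr_eq A C {0} hC (Finset.singleton_nonempty 0)
    have h2 : ∀ ξ : Fin n → ZMod q, sqCoeff {0} ξ = 1 := fun ξ =>
      sqCoeff_eq_one (Finset.singleton_nonempty 0) (by simp)
    simpa [h2] using h1
  rw [h0 B hB, mul_comm u] at hu
  rw [h0 W hWne, mul_comm]
  refine mul_le_mul_of_nonneg_left ?_ (by positivity)
  have hu' := le_of_mul_le_mul_left hu (by positivity)
  have hl' : l ≤ ∑ ξ, sqCoeff A ξ * sqCoeff B ξ * sqCoeff T ξ := by
    have h1 := sum_autoCorr_eq A B T hB hT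
    have h2 : ∑ b ∈ B, ∑ b' ∈ B, ∑ t ∈ T, ∑ t' ∈ T, autoCorr A (b - b' + (t - t')) =
        ∑ t ∈ T, ∑ t' ∈ T, ∑ b ∈ B, ∑ b' ∈ B, autoCorr A (b - b' + (t - t')) := by
      simp only [Finset.sum_comm (s := B) (t := T)]
    rw [h2] at h1
    have h3 : (#T : ℝ) ^ 2 * (l * (#B : ℝ) ^ 2) ≤
        ∑ t ∈ T, ∑ t' ∈ T, ∑ b ∈ B, ∑ b' ∈ B, autoCorr A (b - b' + (t - t')) := by
      calc _ = ∑ t ∈ T, ∑ t' ∈ T, l * (#B : ℝ) ^ 2 := by simp; ring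
        _ ≤ _ := Finset.sum_le_sum fun t h => Finset.sum_le_sum fun t' h' => hl t h t' h'
    rw [h1] at h3
    refine le_of_mul_le_mul_left ?_ (show (0 : ℝ) < (#B : ℝ) ^ 2 * (#T : ℝ) ^ 2 by positivity)
    linarith
  have hpt : ∀ ξ, sqCoeff A ξ * sqCoeff B ξ * sqCoeff T ξ ≤
      sqCoeff A ξ * sqCoeff W ξ + κ ^ 2 * (sqCoeff A ξ * sqCoeff B ξ) := by
    intro ξ
    have a0 := sqCoeff_nonneg A ξ
    have b0 := sqCoeff_nonneg B ξ
    have b1 := sqCoeff_le_one B ξ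
    have t0 := sqCoeff_nonneg T ξ
    have t1 := sqCoeff_le_one T ξ
    have w0 := sqCoeff_nonneg W ξ
    have ab := mul_nonneg a0 b0
    rcases le_or_gt (κ * #T) ‖∑ t ∈ T, dotChar ξ t‖ with h | h
    · rw [sqCoeff_eq_one hWne fun v hv => hV ξ h v (Finset.mem_filter.1 hv).2, mul_one]
      nlinarith [mul_nonneg (sq_nonneg κ) ab]
    · have h1 : sqCoeff T ξ ≤ κ ^ 2 := by
        rw [sqCoeff, div_le_iff₀ (by positivity), ← mul_pow]
        exact pow_le_pow_left₀ (norm_nonneg _) h.le 2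
      nlinarith [mul_nonneg a0 w0]
  have h1 := Finset.sum_le_sum fun ξ (_ : ξ ∈ Finset.univ) => hpt ξ
  rw [Finset.sum_add_distrib, ← Finset.mul_sum] at h1
  nlinarith [mul_le_mul_of_nonneg_left hu' (sq_nonneg κ)]

end Fourier

lemma le_linftyNorm {ι : Type*} [Fintype ι] (f : ι → ℝ) (x : ι) : f x ≤ linftyNorm f :=
  (le_abs_self _).trans (le_ciSup (f := fun x => |f x|) (Set.finite_range _).bddAbove x)

lemma sum_autoCorr_subgroup_le (A : Finset G) (hA : A.Nonempty) (H : AddSubgroup G) :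
    ∑ v with v ∈ H, ∑ v' with v' ∈ H, autoCorr A (v - v') ≤
      (#{v | v ∈ H} : ℝ) ^ 2 * linftyNorm (cv (mu (A : Set G)) (mu (H : Set G))) := by
  set W : Finset G := Finset.univ.filter fun v => v ∈ H with hW
  set c := cv (mu (A : Set G)) (mu (H : Set G)) with hc
  have hN : (0 : ℝ) < (Fintype.card G : ℝ) := by exact_mod_cast Fintype.card_pos
  have ha : (0 : ℝ) < #A := by exact_mod_cast hA.card_pos
  have hw : (0 : ℝ) < #W := by
    have : W.Nonempty := ⟨0, by simp [hW, H.zero_mem]⟩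
    exact_mod_cast this.card_pos
  have hWH : (H : Set G) = W := by ext; simp [hW]
  have hmu : ∀ (S : Finset G) x, mu (S : Set G) x = Fintype.card G / #S * indic (S : Set G) x := by
    intro S x
    simp [mu, indic]
  have h1 : ∀ v' ∈ W, ∑ v ∈ W, autoCorr A (v - v') = ∑ v ∈ W, autoCorr A v := by
    intro v' hv'
    have hv' : v' ∈ H := by simpa [hW] using hv'
    simp only [hW, Finset.sum_filter]
    rw [← Equiv.sum_comp (Equiv.subRight v') fun v => if v ∈ H then autoCorr A v else 0]
    refine Finset.sum_congr rfl fun v _ => ?_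
    simp only [Equiv.subRight_apply, sub_eq_add_neg, H.add_mem_cancel_right (H.neg_mem hv')]
  have h2 : ∀ t, c t = Fintype.card G / (#A * #W) * ∑ v ∈ W, indic (A : Set G) (t + v) := by
    intro t
    rw [hc, cv, ex, hWH, ← Equiv.sum_comp (Equiv.addLeft t), ← sum_mul_indic W,
      Finset.mul_sum, Finset.sum_div]
    refine Finset.sum_congr rfl fun v _ => ?_
    have h3 : indic (W : Set G) (t - (t + v)) = indic (W : Set G) v := by
      simp [indic, hW]
    rw [hmu, hmu, Equiv.coe_addLeft, h3]
    field_simp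
  have h4 : ∑ v ∈ W, autoCorr A v = #W / #A * ∑ t ∈ A, c t := by
    simp only [autoCorr, h2]
    rw [← Finset.mul_sum, ← Finset.mul_sum, Finset.sum_comm]
    simp only [← Finset.mul_sum]
    rw [sum_mul_indic A fun t => ∑ v ∈ W, indic (A : Set G) (t + v)]
    field_simp
  have h5 : ∑ t ∈ A, c t ≤ #A * linftyNorm c := by
    calc _ ≤ ∑ t ∈ A, linftyNorm c := Finset.sum_le_sum fun t _ => le_linftyNorm c t
      _ = _ := by simp
  rw [Finset.sum_comm, Finset.sum_congr rfl h1, Finset.sum_const, nsmul_eq_mul, h4]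
  calc (#W : ℝ) * (#W / #A * ∑ t ∈ A, c t) ≤ #W * (#W / #A * (#A * linftyNorm c)) := by gcongr
    _ = _ := by field_simp

section Unbalanced

lemma mu_coe {ι : Type*} [Fintype ι] (S : Finset ι) (x : ι) :
    mu (S : Set ι) x = Fintype.card ι / #S * indic (S : Set ι) x := by
  simp [mu, indic]

lemma sum_mu {ι : Type*} [Fintype ι] (A : Finset ι) (hA : A.Nonempty) :
    ∑ x, mu (A : Set ι) x = Fintype.card ι := by
  have ha : (#A : ℝ) ≠ 0 := by exact_mod_cast hA.card_pos.ne'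
  simp only [mu_coe, ← Finset.mul_sum, sum_indic, div_mul_cancel₀ _ ha]

lemma autoCorr_eq_mu (A : Finset G) (z : G) :
    autoCorr A z = (∑ t, mu (A : Set G) t * mu (A : Set G) (t + z)) / Fintype.card G := by
  have hN : (Fintype.card G : ℝ) ≠ 0 := by exact_mod_cast Fintype.card_ne_zero
  simp only [autoCorr, mu_coe, mul_mul_mul_comm _ (indic _ _), ← Finset.mul_sum]
  field_simp

lemma autoCorr_sub_one (A : Finset G) (hA : A.Nonempty) (z : G) :
    autoCorr A z - 1 =
      (∑ t, (mu (A : Set G) t - 1) * (mu (A : Set G) (t + z) - 1)) / Fintype.card G := by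
  have hN : (Fintype.card G : ℝ) ≠ 0 := by exact_mod_cast Fintype.card_ne_zero
  have h1 : ∑ t, mu (A : Set G) (t + z) = Fintype.card G :=
    (Equiv.sum_comp (Equiv.addRight z) (mu (A : Set G))).trans (sum_mu A hA)
  have h2 : ∀ t, (mu (A : Set G) t - 1) * (mu (A : Set G) (t + z) - 1) =
      mu (A : Set G) t * mu (A : Set G) (t + z) - mu (A : Set G) t - mu (A : Set G) (t + z) + 1 :=
    fun t => by ring
  simp only [h2, Finset.sum_add_distrib, Finset.sum_sub_distrib, h1, sum_mu A hA, autoCorr_eq_mu]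
  simp
  field_simp

lemma cv_mu_sub_one (A : Finset G) (hA : A.Nonempty) (x : G) :
    cv (mu (A : Set G)) (mu (A : Set G)) x - 1 =
      (∑ y, (mu (A : Set G) y - 1) * (mu (A : Set G) (x - y) - 1)) / Fintype.card G := by
  have hN : (Fintype.card G : ℝ) ≠ 0 := by exact_mod_cast Fintype.card_ne_zero
  have h1 : ∑ y, mu (A : Set G) (x - y) = Fintype.card G :=
    (Equiv.sum_comp (Equiv.subLeft x) (mu (A : Set G))).trans (sum_mu A hA)
  have h2 : ∀ y, (mu (A : Set G) y - 1) * (mu (A : Set G) (x - y) - 1) =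
      mu (A : Set G) y * mu (A : Set G) (x - y) - mu (A : Set G) y - mu (A : Set G) (x - y) + 1 :=
    fun t => by ring
  simp only [h2, Finset.sum_add_distrib, Finset.sum_sub_distrib, h1, sum_mu A hA, cv, ex]
  simp
  field_simp

lemma sum_autoCorr_sub_one_pow_nonneg (A : Finset G) (hA : A.Nonempty) (m : ℕ) :
    0 ≤ ∑ z, (autoCorr A z - 1) ^ m := by
  simp only [autoCorr_sub_one A hA, div_pow, ← Finset.sum_div]
  exact div_nonneg (corr_pow_sum_nonneg _ m) (by positivity)

lemma card_div_le_sum_autoCorr_sub_one_pow (A B : Finset G) (hA : A.Nonempty) (hAB : #B = #A)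
    (h : 2⁻¹ < |ip (cv (mu (A : Set G)) (mu (A : Set G))) (mu (B : Set G)) - 1|) {j : ℕ}
    (hj : 1 ≤ j) : (#A : ℝ) / 4 ^ j ≤ ∑ z, (autoCorr A z - 1) ^ (2 * j) := by
  have hN : (0 : ℝ) < (Fintype.card G : ℝ) := by exact_mod_cast Fintype.card_pos
  have ha : (0 : ℝ) < #A := by exact_mod_cast hA.card_pos
  have heven : Even (2 * j) := even_two_mul j
  set c := cv (mu (A : Set G)) (mu (A : Set G)) with hc
  have h1 : ∑ x, (c x - 1) ^ (2 * j) ≤ ∑ z, (autoCorr A z - 1) ^ (2 * j) := by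
    simp only [autoCorr_sub_one A hA, hc, cv_mu_sub_one A hA, div_pow, ← Finset.sum_div]
    refine div_le_div_of_nonneg_right ?_ (by positivity)
    exact conv_pow_sum_le (fun x => mu (A : Set G) x - 1) (2 * j)
  refine le_trans ?_ h1
  have h2 : ip c (mu (B : Set G)) - 1 = (∑ x ∈ B, (c x - 1)) / #A := by
    simp only [ip, ex, mu_coe, hAB, mul_left_comm (c _), ← Finset.mul_sum]
    rw [Finset.sum_sub_distrib, Finset.sum_const, nsmul_eq_mul, hAB, ← sum_mul_indic B]
    simp only [mul_comm (c _)]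
    field_simp
  have h3 : #A / 2 ≤ ∑ x ∈ B, |c x - 1| := by
    rw [h2, abs_div, abs_of_pos ha, lt_div_iff₀ ha] at h
    have := Finset.abs_sum_le_sum_abs (fun x => c x - 1) B
    linarith
  obtain ⟨i, hi⟩ : ∃ i, 2 * j = i + 1 := ⟨2 * j - 1, by omega⟩
  have h4 : (∑ x ∈ B, |c x - 1|) ^ (i + 1) / (#B : ℝ) ^ i ≤ ∑ x ∈ B, |c x - 1| ^ (i + 1) :=
    pow_sum_div_card_le_sum_pow (fun _ _ => abs_nonneg _) i
  have h5 : ∑ x ∈ B, |c x - 1| ^ (i + 1) ≤ ∑ x, (c x - 1) ^ (2 * j) := by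
    simp only [← hi, heven.pow_abs]
    exact Finset.sum_le_sum_of_subset_of_nonneg (Finset.subset_univ _)
      fun _ _ _ => heven.pow_nonneg _
  refine le_trans ?_ (h4.trans h5)
  have h6 : (#A / 2 : ℝ) ^ (i + 1) ≤ (∑ x ∈ B, |c x - 1|) ^ (i + 1) :=
    pow_le_pow_left₀ (by positivity) h3 _
  rw [hAB, le_div_iff₀ (by positivity)]
  refine le_trans (le_of_eq ?_) h6
  have h7 : (4 : ℝ) ^ j = 2 ^ (i + 1) := by rw [← hi, pow_mul]; norm_num
  rw [h7, div_pow, pow_succ (#A : ℝ)]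
  ring

lemma sum_autoCorr (A : Finset G) (hA : A.Nonempty) : ∑ z, autoCorr A z = Fintype.card G := by
  have hN : (Fintype.card G : ℝ) ≠ 0 := by exact_mod_cast Fintype.card_ne_zero
  have h1 : ∀ t, ∑ z, mu (A : Set G) (t + z) = Fintype.card G := fun t =>
    (Equiv.sum_comp (Equiv.addLeft t) (mu (A : Set G))).trans (sum_mu A hA)
  simp only [autoCorr_eq_mu, ← Finset.sum_div]
  rw [Finset.sum_comm]
  simp only [← Finset.mul_sum, h1, ← Finset.sum_mul, sum_mu A hA]
  field_simp

lemma autoCorr_le (A : Finset G) (z : G) : autoCorr A z ≤ Fintype.card G / #A := by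
  have h1 : ∑ t, indic (A : Set G) t * indic (A : Set G) (t + z) ≤ #A := by
    rw [← sum_indic]
    refine Finset.sum_le_sum fun t _ => mul_le_of_le_one_right (indic_nonneg _ _) ?_
    unfold indic; split_ifs <;> norm_num
  calc autoCorr A z ≤ Fintype.card G / (#A : ℝ) ^ 2 * #A :=
        mul_le_mul_of_nonneg_left h1 (by positivity)
    _ ≤ _ := by
        rw [sq, div_mul_eq_mul_div, mul_comm (#A : ℝ)]
        rcases eq_or_ne (#A : ℝ) 0 with h | h
        · simp [h]
        · rw [mul_div_mul_right _ _ h]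

lemma exists_stable_moment (A : Finset G) (hA : A.Nonempty) {η ρ : ℝ} (hη : 0 ≤ η) (hρ : 1 < ρ)
    {K R : ℕ} (hK : ρ ^ (K + 1) * Fintype.card G ≤ ∑ z, autoCorr A z ^ (K + 1))
    (hR : (Fintype.card G / #A : ℝ) ≤ (1 + η) ^ R) :
    ∃ M ≤ K + R, ∃ lam, ρ ≤ lam ∧ (Fintype.card G : ℝ) ≤ ∑ z, autoCorr A z ^ M ∧
      ∑ z, autoCorr A z ^ M * (autoCorr A z - lam) ^ 2 ≤
        η * lam ^ 2 * ∑ z, autoCorr A z ^ M := by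
  have hN : (0 : ℝ) < (Fintype.card G : ℝ) := by exact_mod_cast Fintype.card_pos
  have hf := autoCorr_nonneg A
  obtain ⟨x, hx⟩ : ∃ x, 0 < autoCorr A x := by
    by_contra! h
    exact (sum_autoCorr A hA ▸ hN).not_ge (Finset.sum_nonpos fun x _ => h x)
  obtain ⟨M, -, hM, lam, hlam, hM1, hM2⟩ := exists_stable_exponent
    (fun i => ∑ z, autoCorr A z ^ i) (B := Fintype.card G / #A) (η := η) (ρ := ρ) (K := K) (R := R)
    (fun i => Finset.sum_pos' (fun z _ => pow_nonneg (hf z) i) ⟨x, Finset.mem_univ _, pow_pos hx i⟩)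
    (fun i => Finset.sum_sq_le_sum_mul_sum_of_sq_le_mul _ (fun z _ => pow_nonneg (hf z) _)
      (fun z _ => pow_nonneg (hf z) _) fun z _ => le_of_eq (by ring))
    (fun i => by
      rw [Finset.mul_sum]
      refine Finset.sum_le_sum fun z _ => ?_
      rw [pow_succ']
      exact mul_le_mul_of_nonneg_right (autoCorr_le A z) (pow_nonneg (hf z) i))
    hη hρ (by simpa [Finset.card_univ] using hK) hR
  refine ⟨M, hM, lam, hlam, ?_, ?_⟩
  · rcases M with _ | i
    · simp [Finset.card_univ]
    · have h1 := pow_sum_div_card_le_sum_pow (s := Finset.univ) (fun z _ => hf z) i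
      rw [sum_autoCorr A hA, Finset.card_univ, pow_succ', mul_div_cancel_right₀ _ (by positivity)]
        at h1
      exact h1
  · have h1 : ∑ z, autoCorr A z ^ M * (autoCorr A z - lam) ^ 2 =
        ∑ z, autoCorr A z ^ (M + 2) - 2 * lam * ∑ z, autoCorr A z ^ (M + 1) +
          lam ^ 2 * ∑ z, autoCorr A z ^ M := by
      rw [Finset.mul_sum, Finset.mul_sum, ← Finset.sum_sub_distrib, ← Finset.sum_add_distrib]
      exact Finset.sum_congr rfl fun z _ => by ring
    rw [h1]
    rw [hM1]
    linarith

end Unbalanced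

section Parameters

lemma lq_ge {α : ℝ} (h0 : 0 < α) (h1 : α ≤ 1) : 0.69 ≤ Lq α := by
  have h2 : Real.log 2 ≤ Lq α := Real.log_le_log two_pos (by rw [le_div_iff₀ h0]; linarith)
  linarith [Real.log_two_gt_d9]

lemma exp_half_le_one_add {η : ℝ} (h0 : 0 ≤ η) (h1 : η ≤ 1) : Real.exp (η / 2) ≤ 1 + η := by
  have h2 := (abs_le.1 (Real.abs_exp_sub_one_sub_id_le
    (x := η / 2) (by rw [abs_of_nonneg (by linarith)]; linarith))).2
  nlinarith

/-- If all even moments of `μ_A ∘ μ_A - 1` are large then `A` has a dense sifted subset on whose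
differences `μ_A ∘ μ_A` is nearly constant, and larger than `9/8`. -/
lemma exists_concentrated_subset (A : Finset G) (hA : A.Nonempty) {α : ℝ}
    (hα : α = #A / Fintype.card G)
    (h : ∀ j, 1 ≤ j → (#A : ℝ) / 4 ^ j ≤ ∑ z, (autoCorr A z - 1) ^ (2 * j)) :
    ∃ lam : ℝ, 9 / 8 ≤ lam ∧ ∃ B : Finset G, B.Nonempty ∧
      -Real.log (#B / Fintype.card G) ≤ 6 * 10 ^ 6 * Lq α ^ 2 ∧
      ∑ x ∈ B, ∑ y ∈ B, (autoCorr A (y - x) - lam) ^ 2 ≤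
        1 / 10 ^ 6 * lam ^ 2 * (#B : ℝ) ^ 2 := by
  have hN : (0 : ℝ) < (Fintype.card G : ℝ) := by exact_mod_cast Fintype.card_pos
  have ha : (0 : ℝ) < #A := by exact_mod_cast hA.card_pos
  have hα0 : 0 < α := hα ▸ by positivity
  have hα1 : α ≤ 1 := by
    rw [hα, div_le_one hN]; exact_mod_cast Finset.card_le_univ A
  have hL := lq_ge hα0 hα1
  set L := Lq α with hLdef
  have hexp : Real.exp L = 2 / α := Real.exp_log (by positivity)
  set j := ⌈4 * L⌉₊ with hj
  have hj1 : 1 ≤ j := Nat.one_le_ceil_iff.2 (by linarith)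
  have hjL : (j : ℝ) ≤ 4 * L + 1 := (Nat.ceil_lt_add_one (by linarith)).le
  have h4j : 16 ≤ α * 4 ^ j := by
    have h1 : (2 / α) ^ 4 ≤ 4 ^ j := by
      calc (2 / α) ^ 4 = Real.exp (4 * L) := by
            rw [← hexp, ← Real.exp_nat_mul]; norm_num
        _ ≤ Real.exp (j * 1) := Real.exp_le_exp.2 (by rw [mul_one]; exact Nat.le_ceil _)
        _ = Real.exp 1 ^ j := Real.exp_nat_mul 1 j
        _ ≤ 4 ^ j := pow_le_pow_left₀ (Real.exp_pos 1).le (by linarith [Real.exp_one_lt_three]) _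
    have h2 : α * (2 / α) ^ 4 = 16 * (1 / α) ^ 3 := by field_simp; norm_num
    have h3 : 1 ≤ (1 / α) ^ 3 := one_le_pow₀ (by rw [le_div_iff₀ hα0]; linarith)
    nlinarith
  have h4pos : (0 : ℝ) < 4 ^ j := by positivity
  have hmom : (9 / 8 : ℝ) ^ (32 * j - 1 + 1) * Fintype.card G ≤
      ∑ z, autoCorr A z ^ (32 * j - 1 + 1) := by
    rw [Nat.sub_add_cancel (by omega)]
    have h1 := sum_pow_ge_of_unbalanced (autoCorr A) (autoCorr_nonneg A) (K := 32 * j) hj1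
      (by omega) (c := α / 4 ^ j) (sum_autoCorr_sub_one_pow_nonneg A hA _)
      (by
        refine le_trans (le_of_eq ?_) (h j hj1)
        rw [hα]; field_simp)
      (by
        rw [pow_mul', sq, one_div_pow, le_div_iff₀ h4pos]
        field_simp
        linarith)
    refine le_trans ?_ h1
    have e1 : 32 * j - 2 * j = 30 * j := by omega
    rw [e1, mul_assoc, mul_comm]
    refine mul_le_mul_of_nonneg_left ?_ hN.le
    have h2 : (1 / 16 : ℝ) ^ j ≤ α / 4 ^ j / 2 := by
      rw [le_div_iff₀ two_pos, le_div_iff₀ h4pos, one_div_pow, show (16 : ℝ) = 4 * 4 by norm_num,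
        mul_pow]
      field_simp
      linarith
    calc (9 / 8 : ℝ) ^ (32 * j) = ((9 / 8) ^ 32) ^ j := pow_mul _ _ _
      _ ≤ (1 / 16 * (5 / 4) ^ 30) ^ j := pow_le_pow_left₀ (by norm_num) (by norm_num) _
      _ = (1 / 16) ^ j * (5 / 4) ^ (30 * j) := by rw [mul_pow, pow_mul]
      _ ≤ _ := mul_le_mul_of_nonneg_right h2 (by positivity)
  set η : ℝ := 1 / (2 * 10 ^ 6) with hη
  set R := ⌈4 * 10 ^ 6 * L⌉₊ with hR
  have hRL : (R : ℝ) ≤ 4 * 10 ^ 6 * L + 1 := (Nat.ceil_lt_add_one (by linarith)).le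
  have hRpow : (Fintype.card G / #A : ℝ) ≤ (1 + η) ^ R := by
    have h1 : (Fintype.card G / #A : ℝ) ≤ 2 / α := by
      rw [hα, div_div_eq_mul_div]
      gcongr
      linarith
    calc _ ≤ 2 / α := h1
      _ = Real.exp L := hexp.symm
      _ ≤ Real.exp (R * (η / 2)) := by
          refine Real.exp_le_exp.2 ?_
          have := Nat.le_ceil (4 * 10 ^ 6 * L)
          rw [← hR] at this
          rw [hη]; linarith
      _ = Real.exp (η / 2) ^ R := Real.exp_nat_mul _ _
      _ ≤ _ := pow_le_pow_left₀ (Real.exp_pos _).le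
          (exp_half_le_one_add (by rw [hη]; norm_num) (by rw [hη]; norm_num)) _
  obtain ⟨M, hM, lam, hlam, hM1, hM2⟩ := exists_stable_moment A hA (η := η) (ρ := 9 / 8)
    (by rw [hη]; norm_num) (by norm_num) hmom hRpow
  obtain ⟨B, hB, hBc, hBv⟩ := exists_sifted A hA M (show 0 < lam by linarith)
    (show 0 < η by rw [hη]; norm_num) hM1 hM2
  refine ⟨lam, hlam, B, hB, ?_, ?_⟩
  · have hb : (0 : ℝ) < #B := by exact_mod_cast hB.card_pos
    rw [← hα] at hBc
    have h1 : α ^ M / 4 ≤ #B / Fintype.card G := (le_div_iff₀ hN).2 hBc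
    have h2 := Real.log_le_log (by positivity) h1
    rw [Real.log_div (by positivity) (by norm_num), Real.log_pow] at h2
    have h3 : Real.log 4 ≤ 2 := by
      have : Real.log 4 = 2 * Real.log 2 := by
        rw [show (4 : ℝ) = 2 ^ 2 by norm_num, Real.log_pow]; norm_num
      linarith [Real.log_two_lt_d9]
    have h4 : -L ≤ Real.log α := by
      rw [hLdef, Lq, Real.log_div two_ne_zero hα0.ne']
      linarith [Real.log_two_gt_d9]
    have h5 : (M : ℝ) ≤ 5 * 10 ^ 6 * L := by
      have h6 : M ≤ 32 * j + R := by omega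
      have h7 : (M : ℝ) ≤ 32 * j + R := by exact_mod_cast h6
      linarith
    have h8 : (M : ℝ) * (-L) ≤ M * Real.log α := mul_le_mul_of_nonneg_left h4 (Nat.cast_nonneg _)
    have h9 : (M : ℝ) * L ≤ 5 * 10 ^ 6 * L * L := mul_le_mul_of_nonneg_right h5 (by linarith)
    nlinarith
  · refine hBv.trans (le_of_eq ?_)
    rw [hη]; ring

lemma exists_concentrated_shifts (f : G → ℝ) (hf : ∀ x, 0 ≤ f x) {lam L : ℝ} (hlam : 0 < lam)
    (hL : 0.69 ≤ L) (B : Finset G) (hB : B.Nonempty)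
    (hBL : -Real.log (#B / Fintype.card G) ≤ 6 * 10 ^ 6 * L ^ 2)
    (hvar : ∑ x ∈ B, ∑ y ∈ B, (f (y - x) - lam) ^ 2 ≤ 1 / 10 ^ 6 * lam ^ 2 * (#B : ℝ) ^ 2) :
    ∑ b ∈ B, ∑ b' ∈ B, f (b - b') ≤ 2 * lam * (#B : ℝ) ^ 2 ∧
    ∃ T : Finset G, T.Nonempty ∧ Real.log (Fintype.card G / #T) ≤ 2 * 10 ^ 18 * L ^ 4 ∧
      ∀ t ∈ T, ∀ t' ∈ T, 94 / 100 * lam * (#B : ℝ) ^ 2 ≤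
        ∑ b ∈ B, ∑ b' ∈ B, f (b - b' + (t - t')) := by
  have hN : (0 : ℝ) < (Fintype.card G : ℝ) := by exact_mod_cast Fintype.card_pos
  have hb : (0 : ℝ) < #B := by exact_mod_cast hB.card_pos
  rw [Finset.sum_comm] at hvar
  have hconst : ∀ c : ℝ, ∑ b ∈ B, ∑ b' ∈ B, c = c * (#B : ℝ) ^ 2 := fun c => by
    simp only [Finset.sum_const, nsmul_eq_mul]; ring
  constructor
  · have h1 : ∀ z, f z ≤ 3 / 2 * lam + 1 / (2 * lam) * (f z - lam) ^ 2 := fun z => by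
      rw [← sub_nonneg]
      have : 3 / 2 * lam + 1 / (2 * lam) * (f z - lam) ^ 2 - f z =
          (f z - 2 * lam) ^ 2 / (2 * lam) := by field_simp; ring
      rw [this]; positivity
    have h2 := Finset.sum_le_sum fun b (_ : b ∈ B) =>
      Finset.sum_le_sum fun b' (_ : b' ∈ B) => h1 (b - b')
    simp only [Finset.sum_add_distrib, hconst] at h2
    simp only [← Finset.mul_sum] at h2
    have h3 := mul_le_mul_of_nonneg_left hvar (show 0 ≤ 1 / (2 * lam) by positivity)
    have h4 : 1 / (2 * lam) * (1 / 10 ^ 6 * lam ^ 2 * (#B : ℝ) ^ 2) =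
        1 / (2 * 10 ^ 6) * (lam * (#B : ℝ) ^ 2) := by field_simp
    have h5 : 0 ≤ lam * (#B : ℝ) ^ 2 := by positivity
    linarith
  · set s : G → ℝ := fun x => if 99 / 100 * lam ≤ f x then 1 else 0 with hs
    have hs0 : ∀ x, 0 ≤ s x := fun x => by simp only [hs]; split_ifs <;> norm_num
    have hs1 : ∀ x, s x ≤ 1 := fun x => by simp only [hs]; split_ifs <;> norm_num
    set k := ⌈28 * 10 ^ 10 * L ^ 2⌉₊ with hk
    have hL2 : 0.47 ≤ L ^ 2 := by nlinarith
    have hk0 : 0 < k := Nat.ceil_pos.2 (by positivity)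
    have hk1 : 28 * 10 ^ 10 * L ^ 2 ≤ k := Nat.le_ceil _
    have hk2 : (k : ℝ) ≤ 3 * 10 ^ 11 * L ^ 2 := by
      have := Nat.ceil_lt_add_one (show 0 ≤ 28 * 10 ^ 10 * L ^ 2 by positivity)
      rw [← hk] at this
      linarith
    obtain ⟨T, hT, hTs⟩ := exists_shift_invariant_set B hB s hs0 hs1 (δ := 1 / 100) (by norm_num)
      (by norm_num) k hk0 (by
        have h1 : Real.exp (-(k * (1 / 100) ^ 2 / 4)) ≤
            Real.exp (Real.log (1 / 400 * (#B / Fintype.card G))) := by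
          refine Real.exp_le_exp.2 ?_
          rw [Real.log_mul (by norm_num) (by positivity),
            show (1 / 400 : ℝ) = 400⁻¹ by norm_num, Real.log_inv]
          have h2 : Real.log 400 ≤ 9 := by
            have h3 : Real.log 400 ≤ Real.log (2 ^ 9) := Real.log_le_log (by norm_num) (by norm_num)
            rw [Real.log_pow] at h3
            norm_num at h3
            linarith [Real.log_two_lt_d9]
          linarith
        rw [Real.exp_log (by positivity)] at h1
        linarith)
    have hTpos : (0 : ℝ) < #T := lt_of_lt_of_le (by positivity) hT
    refine ⟨T, Finset.card_pos.1 (by exact_mod_cast hTpos), ?_, fun t ht t' ht' => ?_⟩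
    · have h1 : (#B / Fintype.card G : ℝ) ^ k / 2 ≤ #T / Fintype.card G := (le_div_iff₀ hN).2 hT
      have h2 := Real.log_le_log (by positivity) h1
      rw [Real.log_div (by positivity) two_ne_zero, Real.log_pow] at h2
      rw [← inv_div, Real.log_inv]
      have h3 : (k : ℝ) * -Real.log (#B / Fintype.card G) ≤
          3 * 10 ^ 11 * L ^ 2 * (6 * 10 ^ 6 * L ^ 2) :=
        (mul_le_mul_of_nonneg_left hBL (Nat.cast_nonneg _)).trans
          (mul_le_mul_of_nonneg_right hk2 (by positivity))
      have h4 : 0.2 ≤ L ^ 4 := by nlinarith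
      linarith [Real.log_two_lt_d9]
    · have h1 : ∀ z, 1 - 10 ^ 4 / lam ^ 2 * (f z - lam) ^ 2 ≤ s z := fun z => by
        by_cases hz : 99 / 100 * lam ≤ f z
        · simp only [hs, hz, if_true]
          have : 0 ≤ 10 ^ 4 / lam ^ 2 * (f z - lam) ^ 2 := by positivity
          linarith
        · simp only [hs, hz, if_false]
          have h2 : (lam / 100) ^ 2 ≤ (f z - lam) ^ 2 := by nlinarith
          have h3 : 1 = 10 ^ 4 / lam ^ 2 * (lam / 100) ^ 2 := by field_simp; norm_num
          have h4 := mul_le_mul_of_nonneg_left h2 (show 0 ≤ 10 ^ 4 / lam ^ 2 by positivity)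
          linarith
      have h2 := Finset.sum_le_sum fun b (_ : b ∈ B) =>
        Finset.sum_le_sum fun b' (_ : b' ∈ B) => h1 (b - b')
      simp only [Finset.sum_sub_distrib, hconst] at h2
      simp only [← Finset.mul_sum] at h2
      have h3 := mul_le_mul_of_nonneg_left hvar (show 0 ≤ 10 ^ 4 / lam ^ 2 by positivity)
      have h4 : 10 ^ 4 / lam ^ 2 * (1 / 10 ^ 6 * lam ^ 2 * (#B : ℝ) ^ 2) =
          1 / 100 * (#B : ℝ) ^ 2 := by field_simp; norm_num
      have h5 := hTs t ht t' ht'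
      have h6 : ∀ z, 99 / 100 * lam * s z ≤ f z := fun z => by
        by_cases hz : 99 / 100 * lam ≤ f z
        · simp [hs, hz]
        · simpa [hs, hz] using hf z
      have h7 := Finset.sum_le_sum fun b (_ : b ∈ B) =>
        Finset.sum_le_sum fun b' (_ : b' ∈ B) => h6 (b - b' + (t - t'))
      simp only [← Finset.mul_sum] at h7
      have h8 : 95 / 100 * (#B : ℝ) ^ 2 ≤ ∑ b ∈ B, ∑ b' ∈ B, s (b - b' + (t - t')) := by linarith
      have h9 := mul_le_mul_of_nonneg_left h8 (show 0 ≤ 99 / 100 * lam by positivity)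
      have h10 : 0 ≤ lam * (#B : ℝ) ^ 2 := by positivity
      linarith

end Parameters

lemma exists_subspace_increment {q n : ℕ} [Fact q.Prime] (A : Finset (Fin n → ZMod q))
    (hA : A.Nonempty) {α : ℝ} (hα : α = #A / Fintype.card (Fin n → ZMod q))
    (h : ∀ j, 1 ≤ j → (#A : ℝ) / 4 ^ j ≤ ∑ z, (autoCorr A z - 1) ^ (2 * j)) :
    ∃ V : Submodule (ZMod q) (Fin n → ZMod q),
      (n : ℝ) - Module.finrank (ZMod q) V ≤ 2 * 10 ^ 21 * Lq α ^ 4 ∧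
      1 + (2 : ℝ) ^ (-5 : ℤ) ≤
        linftyNorm (cv (mu (A : Set (Fin n → ZMod q))) (mu (V : Set (Fin n → ZMod q)))) := by
  have ha : (0 : ℝ) < #A := by exact_mod_cast hA.card_pos
  have hN : (0 : ℝ) < (Fintype.card (Fin n → ZMod q) : ℝ) := by exact_mod_cast Fintype.card_pos
  have hL : 0.69 ≤ Lq α := lq_ge (hα ▸ by positivity)
    (by rw [hα, div_le_one hN]; exact_mod_cast Finset.card_le_univ A)
  obtain ⟨lam, hlam, B, hB, hBL, hvar⟩ := exists_concentrated_subset A hA hα h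
  obtain ⟨hu, T, hT, hTL, hl⟩ := exists_concentrated_shifts (autoCorr A) (autoCorr_nonneg A)
    (show 0 < lam by linarith) hL B hB hBL hvar
  set d := ⌊1800 * 10 ^ 18 * Lq α ^ 4⌋₊ + 1 with hd
  have hL4 : 0.2 ≤ Lq α ^ 4 := by
    have : 0.47 ≤ Lq α ^ 2 := by nlinarith
    nlinarith
  obtain ⟨V, hVd, hV⟩ := exists_annihilator T hT (κ := 1 / 15) (by norm_num) (by norm_num) d (by
    have h1 : 1800 * 10 ^ 18 * Lq α ^ 4 < d := by
      rw [hd, Nat.cast_succ]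
      exact Nat.lt_floor_add_one _
    rw [show ((1 / 15 : ℝ) ^ 2 / 4) = 1 / 900 by norm_num]
    exact lt_of_le_of_lt hTL (by linarith))
  refine ⟨V, ?_, ?_⟩
  · have h1 : (n : ℝ) ≤ Module.finrank (ZMod q) V + d := by exact_mod_cast hVd
    have h2 := Nat.floor_le (show 0 ≤ 1800 * 10 ^ 18 * Lq α ^ 4 by positivity)
    rw [hd] at h1
    push_cast at h1
    linarith
  · have h1 := sum_autoCorr_subspace_ge A B T hB hT V hV hl hu
    have h2 := h1.trans (sum_autoCorr_subgroup_le A hA V.toAddSubgroup)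
    have h3 : (0 : ℝ) < #{v | v ∈ V} := by
      exact_mod_cast Finset.card_pos.2 ⟨0, by simp⟩
    rw [mul_comm] at h2
    have h4 := le_of_mul_le_mul_left h2 (by positivity)
    refine le_trans ?_ h4
    norm_num
    linarith

/-- For `A ⊆ 𝔽_q^n` of density `α`, either
`|⟨μ_A∗μ_A, μ_{−2·A}⟩ − 1| ≤ 2⁻¹`, or there is a subspace `V` of codimension
`O(L(α)^4)` with `‖μ_A∗μ_V‖_∞ ≥ 1 + 2^{−5}`. -/
theorem statement2 :
    ∃ C : ℝ, ∀ (q n : ℕ) [NeZero q], q.Prime → 3 ≤ q → 1 ≤ n →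
      ∀ A : Set (Fin n → ZMod q), A.Nonempty →
        ∀ α : ℝ, α = density A →
          |ip (cv (mu A) (mu A)) (mu ((fun a => (-2 : ZMod q) • a) '' A)) - 1| ≤ 2⁻¹ ∨
          ∃ V : Submodule (ZMod q) (Fin n → ZMod q),
            ((n : ℝ) - (Module.finrank (ZMod q) V : ℝ)) ≤ C * Lq α ^ 4 ∧
            1 + (2 : ℝ) ^ (-5 : ℤ) ≤
              linftyNorm (cv (mu A) (mu (V : Set (Fin n → ZMod q)))) := by
  refine ⟨2 * 10 ^ 21, fun q n _ hq hq3 _ A hA α hα => ?_⟩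
  have : Fact q.Prime := ⟨hq⟩
  refine or_iff_not_imp_left.2 fun h => ?_
  rw [not_le] at h
  have h2 : (-2 : ZMod q) ≠ 0 := by
    have h3 : ((2 : ℕ) : ZMod q) ≠ 0 := fun h0 =>
      absurd (Nat.le_of_dvd two_pos ((ZMod.natCast_eq_zero_iff 2 q).1 h0)) (by omega)
    exact neg_ne_zero.2 (by exact_mod_cast h3)
  lift A to Finset (Fin n → ZMod q) using Set.toFinite A
  rw [Finset.coe_nonempty] at hA
  rw [← Finset.coe_image] at h
  have hcard : #(A.image fun a => (-2 : ZMod q) • a) = #A :=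
    Finset.card_image_of_injective _ (smul_right_injective _ h2)
  exact exists_subspace_increment A hA (by simpa [density] using hα)
    fun j hj => card_div_le_sum_autoCorr_sub_one_pow A _ hA hcard h hj

end Formal
end

section
/- Let q ≥ 3 be prime, G = 𝔽_q^n, let X, A, A₁, A₂ ⊆ G be nonempty, let k ≥ 1 be an integer, and let V ≤ G be a subspace such that γ(t) = 1 for every character γ ∈ Δ_{1/2}(X) and every t ∈ V. Set F = μ_A∘μ_A∘(μ_{A₁}∘μ_{A₂}). Then for every t ∈ V, ‖μ_X^{(k)}∗F(· + t) − μ_X^{(k)}∗F‖_∞ ≤ 2^{1−k} · ⟨μ_A∘μ_A, μ_{A₁}∘μ_{A₁}⟩^{1/2} · ⟨μ_A∘μ_A, μ_{A₂}∘μ_{A₂}⟩^{1/2}. -/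
open Finset BigOperators Pointwise
open scoped Classical

namespace Formal

variable {G : Type*} [AddCommGroup G] [Fintype G]

/-- Double sums of a product separate after the shear `(x, y) ↦ (σ y x, y)`. -/
private lemma sum_sum_mul_shear {α : Type*} [Fintype α] (u v : α → ℂ) (σ : α → α ≃ α)
    (w : α → α → ℂ)
    (hw : ∀ x y, w x y = u y * v (σ y x)) :
    ∑ x, ∑ y, w x y = (∑ y, u y) * ∑ z, v z := by
  rw [Finset.sum_comm, Finset.sum_mul]
  refine Finset.sum_congr rfl fun y _ => ?_
  simp_rw [hw]
  rw [← Finset.mul_sum, (σ y).sum_comp v]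

lemma ft_cv (f g : G → ℝ) (γ : AddChar G ℂ) : ft (cv f g) γ = ft f γ * ft g γ := by
  have key := sum_sum_mul_shear (fun y => (f y : ℂ) * (starRingEnd ℂ) (γ y))
    (fun z => (g z : ℂ) * (starRingEnd ℂ) (γ z)) (fun y => Equiv.subRight y)
    (fun x y => (f y : ℂ) * g (x - y) * (starRingEnd ℂ) (γ x)) (fun x y => by
      have h : γ x = γ y * γ (x - y) := by rw [← AddChar.map_add_eq_mul, add_sub_cancel]
      simp only [Equiv.subRight_apply, h, map_mul]
      ring)
  simp only [ft, cv, ex]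
  rw [div_mul_div_comm, ← key]
  conv_rhs => rw [← div_div, Finset.sum_div]
  congr 1
  refine Finset.sum_congr rfl fun x _ => ?_
  push_cast
  rw [← Finset.sum_mul, div_mul_eq_mul_div]

lemma ft_dcv (f g : G → ℝ) (γ : AddChar G ℂ) :
    ft (dcv f g) γ = (starRingEnd ℂ) (ft f γ) * ft g γ := by
  have key := sum_sum_mul_shear (fun y => (f y : ℂ) * γ y)
    (fun z => (g z : ℂ) * (starRingEnd ℂ) (γ z)) (fun y => Equiv.addRight y)
    (fun x y => (f y : ℂ) * g (x + y) * (starRingEnd ℂ) (γ x)) (fun x y => by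
      have h : (starRingEnd ℂ) (γ x) = γ y * (starRingEnd ℂ) (γ (x + y)) := by
        rw [← AddChar.map_neg_eq_conj, ← AddChar.map_neg_eq_conj, ← AddChar.map_add_eq_mul]
        congr 1
        abel
      simp only [Equiv.coe_addRight, h]
      ring)
  simp only [ft, dcv, ex, map_div₀, map_sum, map_mul, Complex.conj_conj, Complex.conj_ofReal]
  rw [div_mul_div_comm, ← key]
  conv_rhs => rw [← div_div, Finset.sum_div]
  congr 1
  refine Finset.sum_congr rfl fun x _ => ?_
  push_cast
  rw [← Finset.sum_mul, div_mul_eq_mul_div]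

lemma ft_iterConv (f : G → ℝ) (k : ℕ) (γ : AddChar G ℂ) : ft (iterConv f k) γ = ft f γ ^ k := by
  induction k with
  | zero =>
    have h : (Fintype.card G : ℂ) ≠ 0 := Nat.cast_ne_zero.mpr Fintype.card_ne_zero
    simp [ft, iterConv, apply_ite, ite_mul, h]
  | succ k ih => rw [iterConv, ft_cv, ih, pow_succ]

/-- Fourier inversion. -/
lemma sum_ft_mul_apply (f : G → ℝ) (x : G) : ∑ γ : AddChar G ℂ, ft f γ * γ x = f x := by
  have h : (Fintype.card G : ℂ) ≠ 0 := Nat.cast_ne_zero.mpr Fintype.card_ne_zero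
  have key (γ : AddChar G ℂ) :
      ft f γ * γ x = (∑ y, (f y : ℂ) * γ (x - y)) / (Fintype.card G : ℂ) := by
    rw [ft, div_mul_eq_mul_div, Finset.sum_mul, Complex.ofReal_natCast]
    congr 1
    refine Finset.sum_congr rfl fun y _ => ?_
    rw [sub_eq_add_neg, AddChar.map_add_eq_mul, AddChar.map_neg_eq_conj]
    ring
  simp_rw [key]
  rw [← Finset.sum_div, Finset.sum_comm]
  simp_rw [← Finset.mul_sum, AddChar.sum_apply_eq_ite, sub_eq_zero]
  simp [h]

lemma ip_eq_dcv_zero (f g : G → ℝ) : ip f g = dcv f g 0 := by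
  simp [ip, dcv]

lemma ip_dcv_self (f g : G → ℝ) :
    ip (dcv f f) (dcv g g) = ∑ γ : AddChar G ℂ, (‖ft f γ‖ * ‖ft g γ‖) ^ 2 := by
  have h := sum_ft_mul_apply (dcv (dcv f f) (dcv g g)) 0
  rw [ip_eq_dcv_zero, ← Complex.ofReal_inj, ← h, Complex.ofReal_sum]
  refine Finset.sum_congr rfl fun γ _ => ?_
  simp only [ft_dcv, Complex.conj_mul', map_pow, Complex.conj_ofReal, AddChar.map_zero_eq_one]
  push_cast
  ring

/-- Almost-periodicity of `ν^{(k)} ∗ F` along a common period `t` of all the characters at which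
the Fourier transform of `ν` is at least `1 / 2`. -/
lemma abs_cv_iterConv_sub_le (ν f g₁ g₂ : G → ℝ) (k : ℕ) (t x : G)
    (ht : ∀ γ : AddChar G ℂ, 1 / 2 ≤ ‖ft ν γ‖ → γ t = 1) :
    |cv (iterConv ν k) (dcv (dcv f f) (dcv g₁ g₂)) (x + t) -
        cv (iterConv ν k) (dcv (dcv f f) (dcv g₁ g₂)) x| ≤
      (2 : ℝ) ^ (1 - (k : ℤ)) * Real.sqrt (ip (dcv f f) (dcv g₁ g₁)) *
        Real.sqrt (ip (dcv f f) (dcv g₂ g₂)) := by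
  have hpow : (2 : ℝ) ^ (1 - (k : ℤ)) = (1 / 2) ^ k * 2 := by
    rw [zpow_sub₀ two_ne_zero, zpow_one, zpow_natCast, one_div, inv_pow]
    field_simp
  rw [← Real.norm_eq_abs, ← Complex.norm_real, Complex.ofReal_sub, ← sum_ft_mul_apply, ← sum_ft_mul_apply,
    ← Finset.sum_sub_distrib, ip_dcv_self, ip_dcv_self, mul_assoc]
  refine (norm_sum_le _ _).trans (le_trans ?_ (mul_le_mul_of_nonneg_left
    (Real.sum_mul_le_sqrt_mul_sqrt _ _ _) (by positivity)))
  rw [Finset.mul_sum]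
  refine Finset.sum_le_sum fun γ _ => ?_
  have hbound : ‖ft ν γ‖ ^ k * ‖γ t - 1‖ ≤ (1 / 2) ^ k * 2 := by
    rcases le_or_gt (1 / 2) ‖ft ν γ‖ with h | h
    · rw [ht γ h, sub_self, norm_zero, mul_zero]
      positivity
    · have hγ : ‖γ t - 1‖ ≤ 2 := (norm_sub_le _ _).trans (by simp; norm_num)
      gcongr
  rw [← mul_sub, AddChar.map_add_eq_mul, ← mul_sub_one, ft_cv, ft_iterConv, ft_dcv, ft_dcv, ft_dcv,
    hpow]
  simp only [norm_mul, norm_pow, RCLike.norm_conj, AddChar.norm_apply]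
  calc _ = ‖ft ν γ‖ ^ k * ‖γ t - 1‖ * (‖ft f γ‖ * ‖ft g₁ γ‖ * (‖ft f γ‖ * ‖ft g₂ γ‖)) := by ring
    _ ≤ _ := mul_le_mul_of_nonneg_right hbound (by positivity)

/-- If every character in `Δ_{1/2}(X)` is trivial on the subspace `V`, then
for `F = μ_A∘μ_A∘(μ_{A₁}∘μ_{A₂})` and every `t ∈ V`,
`‖μ_X^{(k)}∗F(·+t) − μ_X^{(k)}∗F‖_∞ ≤ 2^{1−k} ⟨μ_A∘μ_A, μ_{A₁}∘μ_{A₁}⟩^{1/2} ⟨μ_A∘μ_A, μ_{A₂}∘μ_{A₂}⟩^{1/2}`. -/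
theorem statement5 (q n : ℕ) [NeZero q] (hq : q.Prime) (hq3 : 3 ≤ q)
    (X A A₁ A₂ : Set (Fin n → ZMod q))
    (hX : X.Nonempty) (hA : A.Nonempty) (hA₁ : A₁.Nonempty) (hA₂ : A₂.Nonempty)
    (k : ℕ) (hk : 1 ≤ k)
    (V : Submodule (ZMod q) (Fin n → ZMod q))
    (hV : ∀ γ ∈ Delta X, ∀ t ∈ V, γ t = 1) :
    ∀ t ∈ V,
      linftyNorm (fun x =>
          cv (iterConv (mu X) k) (dcv (dcv (mu A) (mu A)) (dcv (mu A₁) (mu A₂))) (x + t) -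
          cv (iterConv (mu X) k) (dcv (dcv (mu A) (mu A)) (dcv (mu A₁) (mu A₂))) x) ≤
        (2 : ℝ) ^ (1 - (k : ℤ)) *
          Real.sqrt (ip (dcv (mu A) (mu A)) (dcv (mu A₁) (mu A₁))) *
          Real.sqrt (ip (dcv (mu A) (mu A)) (dcv (mu A₂) (mu A₂))) := by
  intro t ht
  exact ciSup_le fun x => abs_cv_iterConv_sub_le _ _ _ _ k t x fun γ hγ => hV γ hγ t ht

end Formal
end
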